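/- arXiv:1601.03308 — 10 statements merged into one kernel-verified Lean document; each statement's English description precedes it below -/
import Mathlib

section
/- Let d ≥ 2 and let f : ℝ^d → ℝ^d be continuous, open and discrete. Let U' ⊆ ℝ^d be a domain and let U be a bounded connected component of f⁻¹(U'). Then f(U) = U' and U' is bounded. -/
open Set Bornology

theorem stmt_0 (d : ℕ) (hd : 2 ≤ d)
    (f : EuclideanSpace ℝ (Fin d) → EuclideanSpace ℝ (Fin d))
    (hf_cont : Continuous f) (hf_open : IsOpenMap f)
    (hf_disc : ∀ y : EuclideanSpace ℝ (Fin d),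
      DiscreteTopology ↥(f ⁻¹' {y}))
    (U' : Set (EuclideanSpace ℝ (Fin d)))
    (hU'_open : IsOpen U') (hU'_conn : IsConnected U')
    (U : Set (EuclideanSpace ℝ (Fin d)))
    (hU_comp : ∃ x ∈ f ⁻¹' U', U = connectedComponentIn (f ⁻¹' U') x)
    (hU_bdd : IsBounded U) :
    f '' U = U' ∧ IsBounded U' := by
  obtain ⟨x, hx, rfl⟩ := hU_comp
  set U := connectedComponentIn (f ⁻¹' U') x with hU
  have hUo : IsOpen U := (hU'_open.preimage hf_cont).connectedComponentIn
  have hsub : U ⊆ f ⁻¹' U' := connectedComponentIn_subset _ _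
  have hxU : x ∈ U := mem_connectedComponentIn hx
  have hpre : IsPreconnected U := isPreconnected_connectedComponentIn
  have hK : IsCompact (f '' closure U) := hU_bdd.isCompact_closure.image hf_cont
  have hKsub : closure (f '' U) ⊆ f '' closure U :=
    closure_minimal (image_mono subset_closure) hK.isClosed
  have hclosed : closure (f '' U) ∩ U' ⊆ f '' U := by
    rintro y ⟨hy, hyU'⟩
    obtain ⟨z, hz, rfl⟩ := hKsub hy
    refine ⟨z, ?_, rfl⟩
    have hp : IsPreconnected (insert z U) :=
      hpre.subset_closure (subset_insert _ _) (insert_subset hz subset_closure)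
    exact hp.subset_connectedComponentIn (mem_insert_of_mem _ hxU)
      (insert_subset hyU' hsub) (mem_insert _ _)
  have heq : f '' U = U' := by
    apply Subset.antisymm (image_subset_iff.2 hsub)
    exact hU'_conn.isPreconnected.subset_of_closure_inter_subset (hf_open _ hUo)
      ⟨f x, hx, mem_image_of_mem f hxU⟩ hclosed
  refine ⟨heq, ?_⟩
  rw [← heq]
  exact hK.isBounded.subset (image_mono subset_closure)
end

section
/- Let d ≥ 2 and let f : ℝ^d → ℝ^d be continuous, open and discrete. Let U' ⊆ ℝ^d be a domain and let U be a bounded connected component of f⁻¹(U'). Then f(∂U) = ∂U', where ∂ denotes the topological frontier in ℝ^d; in particular U is a normal domain of f. -/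
open Set Bornology

theorem stmt_1 (d : ℕ) (hd : 2 ≤ d)
    (f : EuclideanSpace ℝ (Fin d) → EuclideanSpace ℝ (Fin d))
    (hf_cont : Continuous f) (hf_open : IsOpenMap f)
    (hf_disc : ∀ y : EuclideanSpace ℝ (Fin d),
      DiscreteTopology ↥(f ⁻¹' {y}))
    (U' : Set (EuclideanSpace ℝ (Fin d)))
    (hU'_open : IsOpen U') (hU'_conn : IsConnected U')
    (U : Set (EuclideanSpace ℝ (Fin d)))
    (hU_comp : ∃ x ∈ f ⁻¹' U', U = connectedComponentIn (f ⁻¹' U') x)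
    (hU_bdd : IsBounded U) :
    f '' frontier U = frontier U' ∧ f '' frontier U = frontier (f '' U) := by
  obtain ⟨x, hx, hU⟩ := hU_comp
  have hVo : IsOpen (f ⁻¹' U') := hU'_open.preimage hf_cont
  have hUo : IsOpen U := hU ▸ hVo.connectedComponentIn
  have hxU : x ∈ U := hU ▸ mem_connectedComponentIn hx
  have hUsub : U ⊆ f ⁻¹' U' := hU ▸ connectedComponentIn_subset _ _
  have hUc : IsPreconnected U := hU ▸ isPreconnected_connectedComponentIn
  have key : ∀ z ∈ closure U, f z ∈ U' → z ∈ U := by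
    intro z hz hfz
    have hpre : IsPreconnected (insert z U) :=
      hUc.subset_closure (subset_insert _ _) (insert_subset hz subset_closure)
    have hs : insert z U ⊆ connectedComponentIn (f ⁻¹' U') x :=
      hpre.subset_connectedComponentIn (mem_insert_of_mem _ hxU) (insert_subset hfz hUsub)
    rw [hU]
    exact hs (mem_insert _ _)
  have hK : IsCompact (closure U) := hU_bdd.isCompact_closure
  have hKf : IsClosed (f '' closure U) := (hK.image hf_cont).isClosed
  have himg : f '' U = U' := by
    apply Subset.antisymm (image_subset_iff.2 hUsub)
    have h1 : U' ⊆ f '' U ∪ (f '' closure U)ᶜ := by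
      intro y hy
      by_cases h : y ∈ f '' closure U
      · obtain ⟨z, hz, rfl⟩ := h
        exact Or.inl ⟨z, key z hz hy, rfl⟩
      · exact Or.inr h
    refine hU'_conn.isPreconnected.subset_left_of_subset_union (hf_open U hUo)
      hKf.isOpen_compl ?_ h1 ⟨f x, hx, x, hxU, rfl⟩
    exact disjoint_compl_right_iff_subset.2 (image_mono subset_closure)
  have hcl : f '' closure U = closure U' := by
    rw [← himg]
    exact Subset.antisymm (image_closure_subset_closure_image hf_cont)
      (closure_minimal (image_mono subset_closure) hKf)
  have main : f '' frontier U = frontier U' := by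
    rw [hUo.frontier_eq, hU'_open.frontier_eq, ← hcl]
    ext y
    constructor
    · rintro ⟨z, ⟨hz, hzU⟩, rfl⟩
      exact ⟨⟨z, hz, rfl⟩, fun h => hzU (key z hz h)⟩
    · rintro ⟨⟨z, hz, rfl⟩, hy⟩
      exact ⟨z, ⟨hz, fun h => hy (hUsub h)⟩, rfl⟩
  exact ⟨main, by rw [himg, main]⟩
end

section
/- Let d ≥ 2 and let f : ℝ^d → ℝ^d be continuous, open and discrete. Let U' ⊆ ℝ^d be a domain and let U be a bounded connected component of f⁻¹(U'). Then f maps the outer boundary of U onto the outer boundary of U', i.e. f(∂ hull(U)) = ∂ hull(U'). -/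
open Set Bornology

/-- The topological hull of a set `U ⊆ ℝ^d`: the union of `U` with all bounded
connected components of its complement. -/
def hull {d : ℕ} (U : Set (EuclideanSpace ℝ (Fin d))) :
    Set (EuclideanSpace ℝ (Fin d)) :=
  U ∪ {x | x ∉ U ∧ IsBounded (connectedComponentIn Uᶜ x)}

lemma unicoh {X : Type*} [TopologicalSpace X] [NormalSpace X] [SimplyConnectedSpace X]
    [LocallyPathConnectedSpace X] {A B : Set X} (hA : IsClosed A) (hB : IsClosed B)
    (hA' : IsPreconnected A) (hB' : IsPreconnected B) (hAB : A ∪ B = univ) :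
    IsPreconnected (A ∩ B) := by
  classical
  rw [isPreconnected_iff_subset_of_fully_disjoint_closed (hA.inter hB)]
  intro P Q hP hQ hPQ hd
  by_contra! hcon
  obtain ⟨h1, h2⟩ := hcon
  obtain ⟨q, hq, hqP⟩ := not_subset.1 h1
  obtain ⟨p, hp, hpQ⟩ := not_subset.1 h2
  have hq' : q ∈ Q := (hPQ hq).resolve_left hqP
  have hp' : p ∈ P := (hPQ hp).resolve_right hpQ
  obtain ⟨u, hu0, hu1, -⟩ := exists_continuous_zero_one_of_isClosed hP hQ hd
  let g : X → Circle := fun x => if x ∈ A then Circle.exp (Real.pi * u x)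
    else Circle.exp (-(Real.pi * u x))
  have hg : Continuous g := by
    refine Continuous.if ?_ (by fun_prop) (by fun_prop)
    intro a ha
    have haA : a ∈ A := hA.frontier_subset ha
    have haB : a ∈ B := by
      have : a ∈ closure Aᶜ := by
        rw [frontier_eq_closure_inter_closure] at ha; exact ha.2
      refine closure_minimal ?_ hB this
      intro x hx
      have : x ∈ A ∪ B := hAB ▸ mem_univ x
      exact this.resolve_left hx
    rcases hPQ ⟨haA, haB⟩ with h | h
    · simp [hu0 h]
    · simp only [hu1 h, Pi.one_apply, mul_one]
      have := Circle.periodic_exp (-Real.pi)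
      rw [← this]; congr 1; ring
  have hup : u p = 0 := hu0 hp'
  have huq : u q = 1 := hu1 hq'
  obtain ⟨θ, ⟨hθ0, hθ⟩, -⟩ := Circle.isCoveringMap_exp.existsUnique_continuousMap_lifts ⟨g, hg⟩ p 0
    (by simp [g, hp.1, hup])
  have hθ' : ∀ x, Circle.exp (θ x) = g x := fun x => congrFun hθ x
  have hgB : ∀ x ∈ B, g x = Circle.exp (-(Real.pi * u x)) := by
    intro a haB
    by_cases haA : a ∈ A
    · simp only [g, haA, if_true]
      rcases hPQ ⟨haA, haB⟩ with h | h
      · simp [hu0 h]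
      · simp only [hu1 h, Pi.one_apply, mul_one]
        have := Circle.periodic_exp (-Real.pi)
        rw [← this]; congr 1; ring
    · simp [g, haA]
  have e1 : EqOn θ (fun x => Real.pi * u x) A :=
    Circle.isCoveringMap_exp.eqOn_of_comp_eqOn hA' θ.continuous.continuousOn
      (by fun_prop) (fun x hx => by simp [hθ', g, hx]) hp.1 (by simp [hθ0, hup])
  have e2 : EqOn θ (fun x => -(Real.pi * u x)) B :=
    Circle.isCoveringMap_exp.eqOn_of_comp_eqOn hB' θ.continuous.continuousOn
      (by fun_prop) (fun x hx => by simp [hθ', hgB x hx]) hp.2 (by simp [hθ0, hup])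
  have := (e1 hq.1).symm.trans (e2 hq.2)
  simp only [huq] at this
  linarith [Real.pi_pos]

lemma compl_conn {X : Type*} [TopologicalSpace X] [PreconnectedSpace X] {U C : Set X}
    (hU : IsPreconnected U) (hC : IsClosed C) (hC' : IsPreconnected C) (hne : C.Nonempty)
    (hUC : U ⊆ Cᶜ) (hmax : ∀ S : Set X, IsPreconnected S → S ⊆ Uᶜ → C ⊆ S → S ⊆ C) :
    IsPreconnected Cᶜ := by
  have key : ∀ M N : Set X, IsOpen M → IsOpen N → Cᶜ = M ∪ N → Disjoint M N → U ⊆ M →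
      N = ∅ := by
    intro M N hM hN hcov hd hUM
    have hMC : M ∪ N ⊆ Cᶜ := hcov.ge
    have hpre : IsPreconnected (C ∪ N) := by
      have hcl : IsClosed (C ∪ N) := by
        have : C ∪ N = Mᶜ := by
          ext x
          have h1 : x ∈ Cᶜ ↔ x ∈ M ∪ N := by rw [hcov]
          have h2 : x ∈ M → x ∉ N := fun h h' => Set.disjoint_left.1 hd h h'
          simp only [mem_compl_iff, mem_union] at *
          tauto
        rw [this]; exact hM.isClosed_compl
      have key2 : ∀ S T : Set X, IsClosed S → IsClosed T → C ∪ N ⊆ S ∪ T → Disjoint S T →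
          C ⊆ S → C ∪ N ⊆ S := by
        intro S T hS hT hST hdST hCS
        have hT0 : IsClopen (T ∩ (C ∪ N)) := by
          refine ⟨hT.inter hcl, ?_⟩
          have : T ∩ (C ∪ N) = N ∩ Sᶜ := by
            ext x
            have h2 : x ∈ S → x ∉ T := fun h h' => Set.disjoint_left.1 hdST h h'
            have h3 := @hCS x
            have h4 := @hST x
            simp only [mem_compl_iff, mem_union, mem_inter_iff] at *
            tauto
          rw [this]; exact hN.inter hS.isOpen_compl
        rcases isClopen_iff.1 hT0 with h | h
        · intro x hx
          refine (hST hx).resolve_right fun hxT => ?_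
          have : x ∈ T ∩ (C ∪ N) := ⟨hxT, hx⟩
          rw [h] at this; exact this
        · exfalso
          obtain ⟨c, hc⟩ := hne
          have : c ∈ T ∩ (C ∪ N) := h ▸ mem_univ c
          exact Set.disjoint_left.1 hdST (hCS hc) this.1
      rw [isPreconnected_iff_subset_of_fully_disjoint_closed hcl]
      intro S T hS hT hST hdST
      rcases (isPreconnected_iff_subset_of_fully_disjoint_closed hC).1 hC' S T hS hT
        (subset_union_left.trans hST) hdST with h | h
      · exact Or.inl (key2 S T hS hT hST hdST h)
      · exact Or.inr (key2 T S hT hS (by rwa [union_comm T S]) hdST.symm h)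
    have hsub := hmax _ hpre (by
      rintro x (hx | hx) hxU
      · exact hUC hxU hx
      · exact Set.disjoint_left.1 hd (hUM hxU) hx) subset_union_left
    ext x
    simp only [mem_empty_iff_false, iff_false]
    intro hx
    exact hMC (Or.inr hx) (hsub (Or.inr hx))
  rw [isPreconnected_iff_subset_of_disjoint]
  intro M N hM hN hcov hd
  have hO := hC.isOpen_compl
  have hcov' : Cᶜ = (Cᶜ ∩ M) ∪ (Cᶜ ∩ N) := by
    rw [← inter_union_distrib_left]; exact (inter_eq_left.2 hcov).symm
  have hd' : Disjoint (Cᶜ ∩ M) (Cᶜ ∩ N) := by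
    rw [Set.disjoint_iff_inter_eq_empty, ← hd]; ext x; simp; tauto
  have hUd : U ∩ (M ∩ N) = ∅ := by
    rw [← subset_empty_iff, ← hd]; exact inter_subset_inter_left _ hUC
  rcases (isPreconnected_iff_subset_of_disjoint.1 hU) M N hM hN (hUC.trans hcov) hUd with h | h
  · left
    have := key _ _ (hO.inter hM) (hO.inter hN) hcov' hd' (subset_inter hUC h)
    rw [this, union_empty] at hcov'
    rw [hcov']; exact inter_subset_right
  · right
    have := key _ _ (hO.inter hN) (hO.inter hM) (by rw [union_comm]; exact hcov') hd'.symm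
      (subset_inter hUC h)
    rw [this, empty_union] at hcov'
    rw [hcov']; exact inter_subset_right

lemma outside_conn {d : ℕ} (hd : 2 ≤ d) {R : ℝ} (hR : 0 < R) :
    IsConnected ((Metric.ball (0 : EuclideanSpace ℝ (Fin d)) R)ᶜ) := by
  have hrank : 1 < Module.rank ℝ (EuclideanSpace ℝ (Fin d)) := by
    rw [← Module.finrank_eq_rank]
    simp only [finrank_euclideanSpace, Fintype.card_fin]
    exact_mod_cast hd
  have h1 := isConnected_sphere hrank (0 : EuclideanSpace ℝ (Fin d)) (zero_le_one)
  have h2 : IsConnected (Ici R) := isConnected_Ici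
  have h3 := (h2.prod h1).image (fun p : ℝ × EuclideanSpace ℝ (Fin d) => p.1 • p.2)
    (by fun_prop)
  convert h3 using 1
  ext x
  simp only [mem_compl_iff, Metric.mem_ball, dist_zero_right, not_lt, mem_image, mem_prod, mem_Ici,
    mem_sphere_iff_norm, sub_zero, Prod.exists]
  constructor
  · intro hx
    have hx0 : ‖x‖ ≠ 0 := by linarith
    refine ⟨‖x‖, ‖x‖⁻¹ • x, ⟨hx, ?_⟩, ?_⟩
    · rw [norm_smul, norm_inv, norm_norm, inv_mul_cancel₀ hx0]
    · rw [smul_smul, mul_inv_cancel₀ hx0, one_smul]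
  · rintro ⟨a, b, ⟨ha, hb⟩, rfl⟩
    rw [norm_smul, hb, mul_one, Real.norm_eq_abs]
    exact ha.trans (le_abs_self a)

lemma sep_clopen {X : Type*} [TopologicalSpace X] [T2Space X] {Y S : Set X} (hY : IsCompact Y)
    (hS : IsClosed S) {x : X} (hx : x ∈ Y) (hxS : Disjoint (connectedComponentIn Y x) S) :
    ∃ Z ⊆ Y, IsCompact Z ∧ IsClosed (Y \ Z) ∧ x ∈ Z ∧ Disjoint Z S := by
  have : CompactSpace Y := isCompact_iff_compactSpace.1 hY
  have hne : Nonempty { s : Set Y // IsClopen s ∧ (⟨x, hx⟩ : Y) ∈ s } :=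
    ⟨univ, isClopen_univ, mem_univ _⟩
  obtain ⟨⟨s, hs, hxs⟩, hsS⟩ := exists_subset_nhds_of_isCompact
    (V := fun s : { s : Set Y // IsClopen s ∧ (⟨x, hx⟩ : Y) ∈ s } => (s : Set Y))
    (U := ((↑) : Y → X) ⁻¹' Sᶜ)
    (by
      rintro ⟨s, hs, hxs⟩ ⟨t, ht, hxt⟩
      exact ⟨⟨s ∩ t, hs.inter ht, hxs, hxt⟩, inter_subset_left, inter_subset_right⟩)
    (fun s => s.2.1.1.isCompact)
    (by
      rw [← connectedComponent_eq_iInter_isClopen]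
      intro y hy
      refine (hS.isOpen_compl.preimage continuous_subtype_val).mem_nhds ?_
      intro hyS
      refine Set.disjoint_left.1 hxS ?_ hyS
      rw [connectedComponentIn_eq_image hx]
      exact ⟨y, hy, rfl⟩)
  refine ⟨(↑) '' s, by rintro _ ⟨y, -, rfl⟩; exact y.2,
    hs.1.isCompact.image continuous_subtype_val, ?_, ⟨_, hxs, rfl⟩, ?_⟩
  · have : Y \ ((↑) '' s) = ((↑) : Y → X) '' sᶜ := by
      ext z
      constructor
      · rintro ⟨hz, hzs⟩
        exact ⟨⟨z, hz⟩, fun h => hzs ⟨_, h, rfl⟩, rfl⟩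
      · rintro ⟨y, hy, rfl⟩
        refine ⟨y.2, ?_⟩
        rintro ⟨y', hy', h⟩
        exact hy (Subtype.ext h ▸ hy')
    rw [this]
    exact (hs.compl.1.isCompact.image continuous_subtype_val).isClosed
  · rw [Set.disjoint_left]
    rintro _ ⟨y, hy, rfl⟩ h
    exact hsS hy h

lemma hull_struct {d : ℕ} (hd : 2 ≤ d) {U : Set (EuclideanSpace ℝ (Fin d))}
    (hUo : IsOpen U) (hUb : IsBounded U) :
    ∃ C : Set (EuclideanSpace ℝ (Fin d)), IsClosed C ∧ hull U = Cᶜ ∧ IsConnected C ∧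
      ¬ IsBounded C ∧ C ⊆ Uᶜ ∧
      (∀ S, IsPreconnected S → S ⊆ Uᶜ → (S ∩ C).Nonempty → S ⊆ C) ∧
      (∀ x, x ∉ U → x ∉ C → ∃ W, IsOpen W ∧ IsCompact (W ∩ Uᶜ) ∧ x ∈ W) := by
  obtain ⟨R, hR, hUR⟩ := hUb.subset_ball_lt 0 0
  obtain ⟨⟨p, hp⟩, hO⟩ := outside_conn hd hR
  have hOU : (Metric.ball (0 : EuclideanSpace ℝ (Fin d)) R)ᶜ ⊆ Uᶜ := compl_subset_compl.2 hUR
  have hpU : p ∈ Uᶜ := hOU hp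
  have hOC := hO.subset_connectedComponentIn hp hOU
  have hmax : ∀ S, IsPreconnected S → S ⊆ Uᶜ → (S ∩ connectedComponentIn Uᶜ p).Nonempty →
      S ⊆ connectedComponentIn Uᶜ p := by
    rintro S hS hSU ⟨y, hyS, hyC⟩
    rw [connectedComponentIn_eq hyC]
    exact hS.subset_connectedComponentIn hyS hSU
  have hnb : ¬ IsBounded (connectedComponentIn Uᶜ p) := by
    intro h
    have h2 : IsBounded (univ : Set (EuclideanSpace ℝ (Fin d))) := by
      refine ((h.subset hOC).union Metric.isBounded_ball).subset
        (t := _ ∪ Metric.ball (0 : EuclideanSpace ℝ (Fin d)) R) ?_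
      rw [compl_union_self]
    have : Nontrivial (EuclideanSpace ℝ (Fin d)) := by
      have : Nonempty (Fin d) := ⟨⟨0, by omega⟩⟩
      infer_instance
    exact NormedSpace.unbounded_univ ℝ _ h2
  have hCcl : IsClosed (connectedComponentIn Uᶜ p) := by
    refine isClosed_of_closure_subset (hmax _ isPreconnected_connectedComponentIn.closure
      (closure_minimal (connectedComponentIn_subset _ _) hUo.isClosed_compl)
      ⟨p, subset_closure (mem_connectedComponentIn hpU), mem_connectedComponentIn hpU⟩)
  refine ⟨connectedComponentIn Uᶜ p, hCcl, ?_,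
    isConnected_connectedComponentIn_iff.2 hpU, hnb, connectedComponentIn_subset _ _, hmax, ?_⟩
  · ext x
    simp only [hull, mem_union, mem_setOf_eq, mem_compl_iff]
    constructor
    · rintro (h | ⟨h, hb⟩) hx
      · exact connectedComponentIn_subset _ _ hx h
      · rw [← connectedComponentIn_eq hx] at hb
        exact hnb hb
    · intro hx
      by_cases hxU : x ∈ U
      · exact Or.inl hxU
      · refine Or.inr ⟨hxU, ?_⟩
        refine Metric.isBounded_ball.subset (t := Metric.ball 0 R) ?_
        intro y hy
        by_contra hyR
        exact hx (hmax _ isPreconnected_connectedComponentIn (connectedComponentIn_subset Uᶜ x)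
          ⟨y, hy, hOC hyR⟩ (mem_connectedComponentIn hxU))
  · intro x hxU hxC
    have hxR : x ∈ Metric.ball (0 : EuclideanSpace ℝ (Fin d)) R := by
      by_contra h; exact hxC (hOC h)
    have hY : IsCompact (Metric.closedBall (0 : EuclideanSpace ℝ (Fin d)) R ∩ Uᶜ) :=
      (isCompact_closedBall _ _).inter_right hUo.isClosed_compl
    obtain ⟨Z, hZY, hZ, hYZ, hxZ, hd⟩ := sep_clopen hY
      (Metric.isOpen_ball (x := (0 : EuclideanSpace ℝ (Fin d))) (ε := R)).isClosed_compl
      (x := x) ⟨Metric.ball_subset_closedBall hxR, hxU⟩ (by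
        rw [Set.disjoint_left]
        intro y hy hyR
        exact hxC (hmax _ isPreconnected_connectedComponentIn
          ((connectedComponentIn_subset _ x).trans inter_subset_right)
          ⟨y, hy, hOC hyR⟩
          (mem_connectedComponentIn ⟨Metric.ball_subset_closedBall hxR, hxU⟩)))
    refine ⟨Metric.ball 0 R ∩
      ((Metric.closedBall (0 : EuclideanSpace ℝ (Fin d)) R ∩ Uᶜ) \ Z)ᶜ,
      Metric.isOpen_ball.inter hYZ.isOpen_compl, ?_, hxR, fun h => h.2 hxZ⟩
    convert hZ using 1
    ext y
    constructor
    · rintro ⟨⟨h1, h2⟩, h3⟩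
      by_contra h
      exact h2 ⟨⟨Metric.ball_subset_closedBall h1, h3⟩, h⟩
    · intro h
      refine ⟨⟨?_, fun h' => h'.2 h⟩, (hZY h).2⟩
      by_contra h'
      exact Set.disjoint_left.1 hd h h'

lemma frontier_C {d : ℕ} {U C : Set (EuclideanSpace ℝ (Fin d))} (hC : IsClosed C)
    (hmax : ∀ S, IsPreconnected S → S ⊆ Uᶜ → (S ∩ C).Nonempty → S ⊆ C) :
    frontier C ⊆ closure U := by
  intro y hy
  by_contra hyU
  have hyC : y ∈ C := hC.frontier_subset hy
  obtain ⟨r, hr, hb⟩ := Metric.isOpen_iff.1 isClosed_closure.isOpen_compl y hyU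
  have hsub := hmax (Metric.ball y r) (convex_ball y r).isPreconnected
    (fun z hz hzU => hb hz (subset_closure hzU)) ⟨y, Metric.mem_ball_self hr, hyC⟩
  rw [frontier, mem_diff] at hy
  exact hy.2 (mem_interior.2 ⟨_, hsub, Metric.isOpen_ball, Metric.mem_ball_self hr⟩)

theorem stmt_3 (d : ℕ) (hd : 2 ≤ d)
    (f : EuclideanSpace ℝ (Fin d) → EuclideanSpace ℝ (Fin d))
    (hf_cont : Continuous f) (hf_open : IsOpenMap f)
    (hf_disc : ∀ y : EuclideanSpace ℝ (Fin d),
      DiscreteTopology ↥(f ⁻¹' {y}))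
    (U' : Set (EuclideanSpace ℝ (Fin d)))
    (hU'_open : IsOpen U') (hU'_conn : IsConnected U')
    (U : Set (EuclideanSpace ℝ (Fin d)))
    (hU_comp : ∃ x ∈ f ⁻¹' U', U = connectedComponentIn (f ⁻¹' U') x)
    (hU_bdd : IsBounded U) :
    f '' frontier (hull U) = frontier (hull U') := by
  obtain ⟨x₀, hx₀, hUeq⟩ := hU_comp
  have hx₀U : x₀ ∈ U := hUeq ▸ mem_connectedComponentIn hx₀
  have hUo : IsOpen U := hUeq ▸ (hU'_open.preimage hf_cont).connectedComponentIn
  have hUpre : IsPreconnected U := hUeq ▸ isPreconnected_connectedComponentIn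
  have hUsub : U ⊆ f ⁻¹' U' := hUeq ▸ connectedComponentIn_subset _ _
  have hclU : ∀ x ∈ closure U, f x ∈ U' → x ∈ U := by
    intro x hx hfx
    have h1 : IsPreconnected (insert x U) := hUpre.subset_closure (subset_insert _ _)
      (insert_subset hx subset_closure)
    have h2 := h1.subset_connectedComponentIn (mem_insert_of_mem _ hx₀U)
      (insert_subset hfx hUsub)
    rw [← hUeq] at h2
    exact h2 (mem_insert _ _)
  have hcomp : IsCompact (closure U) := hU_bdd.isCompact_closure
  have hclf : closure (f '' U) ⊆ f '' closure U :=
    closure_minimal (image_mono subset_closure) (hcomp.image hf_cont).isClosed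
  have hfU : f '' U = U' := by
    refine Subset.antisymm (image_subset_iff.2 hUsub) ?_
    refine hU'_conn.isPreconnected.subset_of_closure_inter_subset (hf_open _ hUo)
      ⟨f x₀, hx₀, mem_image_of_mem f hx₀U⟩ ?_
    rintro y ⟨hy, hyU'⟩
    obtain ⟨x, hx, rfl⟩ := hclf hy
    exact ⟨x, hclU x hx hyU', rfl⟩
  rw [hfU] at hclf
  have hU'b : IsBounded U' := (hcomp.image hf_cont).isBounded.subset
    (subset_closure.trans hclf)
  obtain ⟨C, hCcl, hCh, hCconn, hCnb, hCU, hCmax, hCsep⟩ := hull_struct hd hUo hU_bdd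
  obtain ⟨C', hCcl', hCh', hCconn', hCnb', hCU', hCmax', hCsep'⟩ :=
    hull_struct hd hU'_open hU'b
  rw [hCh, hCh', frontier_compl, frontier_compl]
  have claim : ∀ x, f x ∈ C' → x ∈ C := by
    intro x hx
    by_contra hxC
    have hxU : x ∉ U := fun h => hCU' hx (hUsub h)
    obtain ⟨W, hW, hQ, hxW⟩ := hCsep x hxU hxC
    have hsub : C' ⊆ f '' (W ∩ Uᶜ) := by
      have h1 : C' ∩ f '' W ⊆ f '' (W ∩ Uᶜ) := by
        rintro _ ⟨hy, z, hz, rfl⟩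
        exact ⟨z, ⟨hz, fun h => hCU' hy (hUsub h)⟩, rfl⟩
      by_contra hnot
      obtain ⟨z, hz1, hz2⟩ := not_subset.1 hnot
      have h3 := hCconn'.isPreconnected (f '' W) (f '' (W ∩ Uᶜ))ᶜ (hf_open _ hW)
        (hQ.image hf_cont).isClosed.isOpen_compl
        (fun y hy => by
          by_cases h : y ∈ f '' (W ∩ Uᶜ)
          · exact Or.inl (image_mono inter_subset_left h)
          · exact Or.inr h)
        ⟨f x, hx, mem_image_of_mem f hxW⟩ ⟨z, hz1, hz2⟩
      obtain ⟨y, hy, hy1, hy2⟩ := h3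
      exact hy2 (h1 ⟨hy, hy1⟩)
    exact hCnb' ((hQ.image hf_cont).isBounded.subset hsub)
  have hfr : frontier C ⊆ closure U := frontier_C hCcl hCmax
  have hfr' : frontier C' ⊆ closure U' := frontier_C hCcl' hCmax'
  have hFeq : frontier C = C ∩ closure Cᶜ := by
    rw [frontier_eq_closure_inter_closure, hCcl.closure_eq]
  have hFeq' : frontier C' = C' ∩ closure C'ᶜ := by
    rw [frontier_eq_closure_inter_closure, hCcl'.closure_eq]
  have hUCc : U ⊆ Cᶜ := fun x hx h => hCU h hx
  have hUCc' : U' ⊆ C'ᶜ := fun x hx h => hCU' h hx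
  have hsup : frontier C' ⊆ f '' frontier C := by
    intro y hy
    obtain ⟨x, hx, rfl⟩ := hclf (hfr' hy)
    have hyC : f x ∈ C' := hCcl'.frontier_subset hy
    refine ⟨x, ?_, rfl⟩
    rw [hFeq]
    exact ⟨claim x hyC, closure_mono hUCc hx⟩
  refine Subset.antisymm ?_ hsup
  have hpre : IsPreconnected (frontier C) := by
    rw [hFeq]
    have hH : IsPreconnected Cᶜ := compl_conn hUpre hCcl hCconn.isPreconnected hCconn.nonempty
      hUCc (fun S hS hSU hCS => hCmax S hS hSU
        (hCconn.nonempty.mono (subset_inter hCS Subset.rfl)))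
    refine unicoh hCcl isClosed_closure hCconn.isPreconnected hH.closure ?_
    rw [eq_univ_iff_forall]
    intro x
    by_cases h : x ∈ C
    · exact Or.inl h
    · exact Or.inr (subset_closure h)
  have hne : (frontier C').Nonempty := by
    refine nonempty_frontier_iff.2 ⟨hCconn'.nonempty, ?_⟩
    intro h
    exact hUCc' hx₀ (h ▸ mem_univ (f x₀))
  have himg : f '' frontier C ⊆ C' := by
    refine hCmax' _ (hpre.image f hf_cont.continuousOn) ?_ ?_
    · rintro _ ⟨x, hx, rfl⟩ hfx
      exact hCU (hCcl.frontier_subset hx) (hclU x (hfr hx) hfx)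
    · obtain ⟨y, hy⟩ := hne
      exact ⟨y, hsup hy, hCcl'.frontier_subset hy⟩
  rintro _ ⟨x, hx, rfl⟩
  rw [hFeq']
  refine ⟨himg ⟨x, hx, rfl⟩, closure_mono hUCc' ?_⟩
  rw [← hfU]
  exact image_closure_subset_closure_image hf_cont ⟨x, hfr hx, rfl⟩
end

section
/- Let d ≥ 2 and let f : ℝ^d → ℝ^d be continuous, open and discrete. Let U' ⊆ ℝ^d be a domain and let U be a bounded connected component of f⁻¹(U'). Then f(hull(U)) = hull(U'). -/
open Set Bornology

lemma compIn_isClosed {X : Type*} [TopologicalSpace X] {F : Set X} (hF : IsClosed F) (x : X) :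
    IsClosed (connectedComponentIn F x) := by
  by_cases hx : x ∈ F
  · apply isClosed_of_closure_subset
    apply IsPreconnected.subset_connectedComponentIn
    · exact isPreconnected_connectedComponentIn.closure
    · exact subset_closure (mem_connectedComponentIn hx)
    · exact closure_minimal (connectedComponentIn_subset F x) hF
  · rw [connectedComponentIn_eq_empty hx]; exact isClosed_empty

lemma unicoherent {X : Type*} [NormedAddCommGroup X] [NormedSpace ℝ X] {D E : Set X}
    (hD : IsClosed D) (hE : IsClosed E) (hDc : IsPreconnected D) (hEc : IsPreconnected E)
    (hU : D ∪ E = univ) : IsPreconnected (D ∩ E) := by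
  classical
  rw [isPreconnected_closed_iff]
  intro t t' ht ht' hsub hA hB
  by_contra hne
  have hdisj : Disjoint (D ∩ E ∩ t) (D ∩ E ∩ t') := by
    rw [Set.disjoint_left]
    intro x hx hx'
    exact hne ⟨x, hx.1, hx.2, hx'.2⟩
  obtain ⟨φ, h0, h1, -⟩ := exists_continuous_zero_one_of_isClosed
    ((hD.inter hE).inter ht) ((hD.inter hE).inter ht') hdisj
  obtain ⟨a, ha⟩ := hA
  obtain ⟨b, hb⟩ := hB
  have e0 : φ a = 0 := h0 ha
  have e1 : φ b = 1 := h1 hb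
  let g : X → Circle := fun x => if x ∈ D then Circle.exp (Real.pi * φ x)
    else Circle.exp (-(Real.pi * φ x))
  have gD : EqOn g (fun x => Circle.exp (Real.pi * φ x)) D := fun x hx => by simp [g, hx]
  have hpi : Circle.exp (Real.pi) = Circle.exp (-Real.pi) := by
    rw [Circle.exp_eq_exp]
    exact ⟨1, by push_cast; ring⟩
  have gE : EqOn g (fun x => Circle.exp (-(Real.pi * φ x))) E := fun x hx => by
    by_cases hxD : x ∈ D
    · rw [gD hxD]
      rcases hsub ⟨hxD, hx⟩ with h | h
      · have : φ x = 0 := h0 ⟨⟨hxD, hx⟩, h⟩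
        simp [this]
      · have : φ x = 1 := h1 ⟨⟨hxD, hx⟩, h⟩
        simp only [this, mul_one, hpi]
    · simp [g, hxD]
  have gc : Continuous g := by
    rw [← continuousOn_univ, ← hU]
    refine ContinuousOn.union_of_isClosed ?_ ?_ hD hE
    · exact ContinuousOn.congr (by fun_prop) gD
    · exact ContinuousOn.congr (by fun_prop) gE
  obtain ⟨e, he⟩ := Circle.exp_surjective (g a)
  obtain ⟨ψ, ⟨-, hψ⟩, -⟩ := Circle.isCoveringMap_exp.existsUnique_continuousMap_lifts
    ⟨g, gc⟩ a e he
  have hψ' : ∀ x, Circle.exp (ψ x) = g x := fun x => congrFun hψ x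
  have ea : Circle.exp (ψ a) = 1 := by rw [hψ', gD ha.1.1]; simp [e0]
  have r1 := Circle.isCoveringMap_exp.eqOn_of_comp_eqOn (s := D) (g₁ := ψ)
    (g₂ := fun x => Real.pi * φ x + ψ a) hDc (by fun_prop) (by fun_prop)
    (fun x hx => by simp [Circle.exp_add, ea, hψ', gD hx]) ha.1.1 (by simp [e0]) hb.1.1
  have r2 := Circle.isCoveringMap_exp.eqOn_of_comp_eqOn (s := E) (g₁ := ψ)
    (g₂ := fun x => -(Real.pi * φ x) + ψ a) hEc (by fun_prop) (by fun_prop)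
    (fun x hx => by simp [Circle.exp_add, ea, hψ', gE hx]) ha.1.2 (by simp [e0]) hb.1.2
  simp only [e1] at r1 r2
  have := Real.pi_pos
  linarith

lemma sep_compact {X : Type*} [NormedAddCommGroup X] [ProperSpace X] {F O : Set X}
    (hF : IsClosed F) (hO : IsOpen O) {x : X} (hx : x ∈ F)
    (hb : IsBounded (connectedComponentIn F x)) (hs : connectedComponentIn F x ⊆ O) :
    ∃ K N : Set X, IsCompact K ∧ IsOpen N ∧ x ∈ K ∧ K ⊆ O ∧ K = F ∩ N := by
  obtain ⟨R, hR⟩ := hb.subset_ball (0 : X)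
  have hxA := mem_connectedComponentIn hx
  set S : Set X := F ∩ Metric.closedBall 0 R with hS
  have hSc : IsCompact S := (isCompact_closedBall 0 R).inter_left hF
  have : CompactSpace S := isCompact_iff_compactSpace.mp hSc
  have hxS : x ∈ S := ⟨hx, Metric.ball_subset_closedBall (hR hxA)⟩
  let a : S := ⟨x, hxS⟩
  let G : Set S := Subtype.val ⁻¹' (O ∩ Metric.ball 0 R)
  have hG : IsOpen G := (hO.inter Metric.isOpen_ball).preimage continuous_subtype_val
  have hsub : connectedComponent a ⊆ G := by
    intro z hz
    have : (z : X) ∈ connectedComponentIn S x := by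
      rw [connectedComponentIn_eq_image hxS]; exact ⟨z, hz, rfl⟩
    have := connectedComponentIn_mono x inter_subset_left this
    exact ⟨hs this, hR this⟩
  rw [connectedComponent_eq_iInter_isClopen] at hsub
  obtain ⟨Z, hZ⟩ : ∃ Z : { s : Set S // IsClopen s ∧ a ∈ s }, (Z : Set S) ⊆ G := by
    have : Nonempty { s : Set S // IsClopen s ∧ a ∈ s } := ⟨⟨univ, isClopen_univ, mem_univ _⟩⟩
    apply exists_subset_nhds_of_compactSpace
    · intro s t
      exact ⟨⟨s.1 ∩ t.1, s.2.1.inter t.2.1, s.2.2, t.2.2⟩, inter_subset_left, inter_subset_right⟩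
    · exact fun s => s.2.1.1
    · exact fun y hy => hG.mem_nhds (hsub hy)
  obtain ⟨N0, hN0, hNZ⟩ := isOpen_induced_iff.mp Z.2.1.2
  refine ⟨Subtype.val '' Z.1, N0 ∩ Metric.ball 0 R, Z.2.1.1.isCompact.image continuous_subtype_val,
    hN0.inter Metric.isOpen_ball, ⟨a, Z.2.2, rfl⟩, ?_, ?_⟩
  · rintro _ ⟨z, hz, rfl⟩; exact (hZ hz).1
  · ext y
    constructor
    · rintro ⟨z, hz, rfl⟩
      have h2 := hz
      rw [← hNZ] at h2
      exact ⟨z.2.1, h2, (hZ hz).2⟩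
    · rintro ⟨h1, h2, h3⟩
      refine ⟨⟨y, h1, Metric.ball_subset_closedBall h3⟩, ?_, rfl⟩
      rw [← hNZ]; exact h2

lemma lift_comp {X : Type*} [NormedAddCommGroup X] [ProperSpace X] {f : X → X}
    (hc : Continuous f) (ho : IsOpenMap f) {C O : Set X} (hC : IsClosed C) (hCc : IsPreconnected C)
    (hO : IsOpen O) {x : X} (hx : f x ∈ C) (hb : IsBounded (connectedComponentIn (f ⁻¹' C) x))
    (hs : connectedComponentIn (f ⁻¹' C) x ⊆ O) :
    ∃ K, IsCompact K ∧ K ⊆ O ∧ C ⊆ f '' K := by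
  obtain ⟨K, N, hK, hN, hxK, hKO, hKN⟩ := sep_compact (hC.preimage hc) hO hx hb hs
  refine ⟨K, hK, hKO, ?_⟩
  have key : C ∩ f '' N ⊆ f '' K := by
    rintro _ ⟨h1, n, hn, rfl⟩
    exact ⟨n, by rw [hKN]; exact ⟨h1, hn⟩, rfl⟩
  intro y hy
  by_contra hyK
  obtain ⟨z, hz, h1, h2⟩ := hCc (f '' N) (f '' K)ᶜ (ho N hN) (hK.image hc).isClosed.isOpen_compl
    (fun z hz => by
      by_cases h : z ∈ f '' K
      · left
        have : K ⊆ N := by rw [hKN]; exact inter_subset_right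
        exact image_mono this h
      · right; exact h)
    ⟨f x, hx, x, by rw [hKN] at hxK; exact hxK.2, rfl⟩ ⟨y, hy, hyK⟩
  exact h2 (key ⟨hz, h1⟩)

lemma comp_nhds {X : Type*} [NormedAddCommGroup X] [NormedSpace ℝ X] {U : Set X} {x c : X}
    (hc : c ∈ connectedComponentIn Uᶜ x) (hcU : c ∉ closure U) :
    connectedComponentIn Uᶜ x ∈ nhds c := by
  rw [connectedComponentIn_eq hc]
  apply connectedComponentIn_mem_nhds
  exact Filter.mem_of_superset (isClosed_closure.isOpen_compl.mem_nhds hcU)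
    (compl_subset_compl.mpr subset_closure)

lemma comp_meets {X : Type*} [NormedAddCommGroup X] [NormedSpace ℝ X] {U : Set X}
    (hU : IsOpen U) (hne : U.Nonempty) {x : X} (hx : x ∈ Uᶜ) :
    (connectedComponentIn Uᶜ x ∩ closure U).Nonempty := by
  by_contra h
  have hop : IsOpen (connectedComponentIn Uᶜ x) := by
    rw [isOpen_iff_mem_nhds]
    intro c hc
    exact comp_nhds hc (fun h' => h ⟨c, hc, h'⟩)
  have := IsClopen.eq_univ ⟨compIn_isClosed hU.isClosed_compl x, hop⟩
    ⟨x, mem_connectedComponentIn hx⟩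
  obtain ⟨u, hu⟩ := hne
  exact connectedComponentIn_subset Uᶜ x (this ▸ mem_univ u) hu

lemma ext_conn {d : ℕ} (hd : 2 ≤ d) {R : ℝ} (hR : 0 ≤ R) :
    IsPreconnected {x : EuclideanSpace ℝ (Fin d) | R < ‖x‖} := by
  have h1 : 1 < Module.rank ℝ (EuclideanSpace ℝ (Fin d)) := by
    rw [← Module.finrank_eq_rank, finrank_euclideanSpace_fin]; exact_mod_cast hd
  have h2 := (isPreconnected_sphere h1 (0 : EuclideanSpace ℝ (Fin d)) 1)
  have h3 := ((isPreconnected_Ioi (a := R)).prod h2).image (fun p => p.1 • p.2) (by fun_prop)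
  convert h3 using 1
  ext x
  simp only [mem_setOf_eq, mem_image, mem_prod, mem_Ioi, mem_sphere_iff_norm, sub_zero, Prod.exists]
  constructor
  · intro h
    have : ‖x‖ ≠ 0 := by linarith
    exact ⟨‖x‖, ‖x‖⁻¹ • x, ⟨h, by simp [norm_smul, this]⟩, by simp [smul_smul, this]⟩
  · rintro ⟨r, y, ⟨hr, hy⟩, rfl⟩
    rw [norm_smul, hy, mul_one, Real.norm_eq_abs]
    exact lt_of_lt_of_le hr (le_abs_self r)

lemma not_bdd_ext {d : ℕ} (hd : 2 ≤ d) (R : ℝ) :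
    ¬ IsBounded {x : EuclideanSpace ℝ (Fin d) | R < ‖x‖} := by
  intro h
  obtain ⟨M, hM⟩ := h.exists_norm_le
  have : Nonempty (Fin d) := ⟨⟨0, by omega⟩⟩
  obtain ⟨x, hx⟩ := NormedSpace.exists_lt_norm ℝ (EuclideanSpace ℝ (Fin d)) (max R M)
  exact absurd (hM x ((le_max_left _ _).trans_lt hx)) (not_le.mpr ((le_max_right _ _).trans_lt hx))

/-- The unbounded component of the complement of a bounded set is the complement of the hull. -/
lemma ext_comp {d : ℕ} (hd : 2 ≤ d) {U : Set (EuclideanSpace ℝ (Fin d))} (hb : IsBounded U) :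
    ∃ p ∈ Uᶜ, ¬ IsBounded (connectedComponentIn Uᶜ p) ∧ (hull U)ᶜ = connectedComponentIn Uᶜ p := by
  obtain ⟨R, hR0, hR⟩ := hb.exists_pos_norm_le
  have hsub : {x : EuclideanSpace ℝ (Fin d) | R < ‖x‖} ⊆ Uᶜ := fun x hx hU =>
    absurd (hR x hU) (not_le.mpr hx)
  have hne := not_bdd_ext hd R
  obtain ⟨p, hp⟩ : {x : EuclideanSpace ℝ (Fin d) | R < ‖x‖}.Nonempty := by
    by_contra h
    rw [not_nonempty_iff_eq_empty] at h
    exact hne (h ▸ isBounded_empty)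
  have hpsub := (ext_conn hd hR0.le).subset_connectedComponentIn hp hsub
  have hpb : ¬ IsBounded (connectedComponentIn Uᶜ p) := fun h => hne (h.subset hpsub)
  refine ⟨p, hsub hp, hpb, ?_⟩
  ext x
  simp only [hull, mem_compl_iff, mem_union, mem_setOf_eq, not_or, not_and]
  constructor
  · rintro ⟨h1, h2⟩
    have h3 := h2 h1
    obtain ⟨q, hq, hqR⟩ : ∃ q ∈ connectedComponentIn Uᶜ x, R < ‖q‖ := by
      by_contra! hcon
      exact h3 (isBounded_iff_forall_norm_le.mpr ⟨R, hcon⟩)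
    have := hpsub hqR
    rw [connectedComponentIn_eq this, ← connectedComponentIn_eq hq]
    exact mem_connectedComponentIn h1
  · intro hx
    refine ⟨connectedComponentIn_subset _ _ hx, fun _ => ?_⟩
    rwa [← connectedComponentIn_eq hx]

lemma closure_hull_conn {d : ℕ} {U : Set (EuclideanSpace ℝ (Fin d))} (hU : IsOpen U)
    (hc : IsConnected U) : IsPreconnected (closure (hull U)) := by
  have hM : IsPreconnected (closure U ∪ hull U) := by
    obtain ⟨u, hu⟩ := hc.nonempty
    apply isPreconnected_of_forall u
    intro y hy
    have hcl := hc.isPreconnected.closure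
    by_cases hyc : y ∈ closure U
    · exact ⟨closure U, subset_union_left, subset_closure hu, hyc, hcl⟩
    · have hyU : y ∉ U := fun h => hyc (subset_closure h)
      have hyb : IsBounded (connectedComponentIn Uᶜ y) := by
        rcases hy with h | h | h
        · exact absurd h hyc
        · exact absurd h hyU
        · exact h.2
      obtain ⟨z, hz1, hz2⟩ := comp_meets hU hc.nonempty (x := y) hyU
      refine ⟨closure U ∪ connectedComponentIn Uᶜ y, ?_, Or.inl (subset_closure hu),
        Or.inr (mem_connectedComponentIn hyU),
        hcl.union z hz2 hz1 isPreconnected_connectedComponentIn⟩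
      apply union_subset_union_right
      intro w hw
      exact Or.inr ⟨connectedComponentIn_subset _ _ hw, by rwa [← connectedComponentIn_eq hw]⟩
  have hUV : U ⊆ hull U := subset_union_left
  have h : closure (hull U) = closure (closure U ∪ hull U) := by
    apply Subset.antisymm (closure_mono subset_union_right)
    exact closure_minimal (union_subset (closure_mono hUV) subset_closure) isClosed_closure
  rw [h]
  exact hM.closure

theorem stmt_4 (d : ℕ) (hd : 2 ≤ d)
    (f : EuclideanSpace ℝ (Fin d) → EuclideanSpace ℝ (Fin d))
    (hf_cont : Continuous f) (hf_open : IsOpenMap f)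
    (hf_disc : ∀ y : EuclideanSpace ℝ (Fin d),
      DiscreteTopology ↥(f ⁻¹' {y}))
    (U' : Set (EuclideanSpace ℝ (Fin d)))
    (hU'_open : IsOpen U') (hU'_conn : IsConnected U')
    (U : Set (EuclideanSpace ℝ (Fin d)))
    (hU_comp : ∃ x ∈ f ⁻¹' U', U = connectedComponentIn (f ⁻¹' U') x)
    (hU_bdd : IsBounded U) :
    f '' hull U = hull U' := by
  obtain ⟨x₀, hx₀, hU⟩ := hU_comp
  have hpre : IsOpen (f ⁻¹' U') := hU'_open.preimage hf_cont
  have hUo : IsOpen U := hU ▸ hpre.connectedComponentIn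
  have hUc : IsConnected U := by
    rw [hU]; exact isConnected_connectedComponentIn_iff.mpr hx₀
  have hUsub : U ⊆ f ⁻¹' U' := hU ▸ connectedComponentIn_subset _ _
  -- closure points of the component lying over the target belong to the component
  have hcl : ∀ x ∈ closure U, f x ∈ U' → x ∈ U := by
    intro x hx hfx
    have h1 : connectedComponentIn (f ⁻¹' U') x ∈ nhds x :=
      connectedComponentIn_mem_nhds (hpre.mem_nhds hfx)
    obtain ⟨z, hz1, hz2⟩ := mem_closure_iff_nhds.mp hx _ h1
    rw [hU] at hz2 ⊢
    rw [connectedComponentIn_eq hz2, ← connectedComponentIn_eq hz1]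
    exact mem_connectedComponentIn hfx
  have hKc : IsCompact (closure U) := hU_bdd.isCompact_closure
  have hfK : IsClosed (f '' closure U) := (hKc.image hf_cont).isClosed
  have hsurj : U' ⊆ f '' U := by
    intro y hy
    by_contra hyU
    have hk : ∀ z ∈ U', z ∈ f '' closure U → z ∈ f '' U := by
      rintro _ hz ⟨u, hu, rfl⟩
      exact ⟨u, hcl u hu hz, rfl⟩
    obtain ⟨z, hz, h1, h2⟩ := hU'_conn.isPreconnected (f '' U) (f '' closure U)ᶜ (hf_open U hUo)
      hfK.isOpen_compl
      (fun z hz => by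
        by_cases h : z ∈ f '' closure U
        · exact Or.inl (hk z hz h)
        · exact Or.inr h)
      ⟨f x₀, hx₀, x₀, hU ▸ mem_connectedComponentIn hx₀, rfl⟩
      ⟨y, hy, fun h => hyU (hk y hy h)⟩
    exact h2 (image_mono subset_closure h1)
  have hclsurj : closure U' ⊆ f '' closure U :=
    closure_minimal (hsurj.trans (image_mono subset_closure)) hfK
  have hU'_bdd : IsBounded U' :=
    (hKc.image hf_cont).isBounded.subset (subset_closure.trans hclsurj)
  obtain ⟨p, hpU, hpb, hE⟩ := ext_comp hd hU_bdd
  obtain ⟨q, hqU, hqb, hE'⟩ := ext_comp hd hU'_bdd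
  have hEclosed : IsClosed (hull U)ᶜ := hE ▸ compIn_isClosed hUo.isClosed_compl p
  have hVo : IsOpen (hull U) := by simpa using hEclosed.isOpen_compl
  -- lifting
  have hlift : ∀ x ∈ hull U, f x ∉ U' →
      ∃ K, IsCompact K ∧ K ⊆ hull U ∧ connectedComponentIn U'ᶜ (f x) ⊆ f '' K := by
    intro x hx hfx
    have hxU : x ∉ U := fun h => hfx (hUsub h)
    have hxb : IsBounded (connectedComponentIn Uᶜ x) := by
      rcases hx with h | h
      · exact absurd h hxU
      · exact h.2
    have hmem : f x ∈ connectedComponentIn U'ᶜ (f x) := mem_connectedComponentIn hfx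
    have hsub : connectedComponentIn (f ⁻¹' connectedComponentIn U'ᶜ (f x)) x
        ⊆ connectedComponentIn Uᶜ x := by
      apply connectedComponentIn_mono
      intro z hz hzU
      exact connectedComponentIn_subset _ _ hz (hUsub hzU)
    refine lift_comp hf_cont hf_open (compIn_isClosed hU'_open.isClosed_compl _)
      isPreconnected_connectedComponentIn hVo hmem (hxb.subset hsub) (hsub.trans ?_)
    intro w hw
    exact Or.inr ⟨connectedComponentIn_subset _ _ hw, by rwa [← connectedComponentIn_eq hw]⟩
  have hforward : ∀ x ∈ hull U, f x ∈ hull U' := by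
    intro x hx
    by_cases hfx : f x ∈ U'
    · exact Or.inl hfx
    · obtain ⟨K, hK, -, hsub⟩ := hlift x hx hfx
      exact Or.inr ⟨hfx, (hK.image hf_cont).isBounded.subset hsub⟩
  -- the outer boundary of `U`
  have hBconn : IsPreconnected (closure (hull U) ∩ (hull U)ᶜ) := by
    apply unicoherent isClosed_closure hEclosed (closure_hull_conn hUo hUc)
    · rw [hE]; exact isPreconnected_connectedComponentIn
    · rw [eq_univ_iff_forall]
      intro x
      by_cases h : x ∈ hull U
      · exact Or.inl (subset_closure h)
      · exact Or.inr h
  have hBsub : f '' (closure (hull U) ∩ (hull U)ᶜ) ⊆ U'ᶜ := by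
    rintro _ ⟨x, ⟨hx1, hx2⟩, rfl⟩ hfx
    have hxcl : x ∈ closure U := by
      by_contra hcon
      have hx3 := hx2
      rw [hE] at hx3
      have := comp_nhds hx3 hcon
      rw [← hE] at this
      obtain ⟨z, hz1, hz2⟩ := mem_closure_iff_nhds.mp hx1 _ this
      exact hz1 hz2
    exact hx2 (Or.inl (hcl x hxcl hfx))
  have hUV : U ⊆ hull U := subset_union_left
  apply Subset.antisymm
  · rintro _ ⟨x, hx, rfl⟩
    exact hforward x hx
  · rintro y (hy | ⟨hy, hyb⟩)
    · exact image_mono hUV (hsurj hy)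
    obtain ⟨z, hz1, hz2⟩ := comp_meets hU'_open hU'_conn.nonempty (x := y) hy
    obtain ⟨u, hu, rfl⟩ := hclsurj hz2
    by_cases huV : u ∈ hull U
    · obtain ⟨K, -, hKV, hsub⟩ := hlift u huV (connectedComponentIn_subset _ _ hz1)
      rw [← connectedComponentIn_eq hz1] at hsub
      exact image_mono hKV (hsub (mem_connectedComponentIn hy))
    · exfalso
      have hfB := (hBconn.image f hf_cont.continuousOn).subset_connectedComponentIn
        ⟨u, ⟨closure_mono hUV hu, huV⟩, rfl⟩ hBsub
      rw [← connectedComponentIn_eq hz1] at hfB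
      obtain ⟨w, hw1, hw2⟩ := comp_meets hU'_open hU'_conn.nonempty (x := q) hqU
      obtain ⟨u', hu', rfl⟩ := hclsurj hw2
      by_cases hu'V : u' ∈ hull U
      · have h1 : f u' ∈ (hull U')ᶜ := by rw [hE']; exact hw1
        exact h1 (hforward u' hu'V)
      · have h2 := hfB ⟨u', ⟨closure_mono hUV hu', hu'V⟩, rfl⟩
        rw [connectedComponentIn_eq hw1, ← connectedComponentIn_eq h2] at hqb
        exact hqb hyb
end

section
/- Let d ≥ 2 and let f : ℝ^d → ℝ^d be continuous, open and discrete. Let U' ⊆ ℝ^d be a domain and let U be a bounded connected component of f⁻¹(U'). If V is a bounded connected component of ℝ^d \ U, then f(V) is a bounded connected component of ℝ^d \ U'. -/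
open Set Bornology

/-- A compact component of a closed set has arbitrarily small bounded open neighbourhoods whose
frontier misses the closed set. -/
lemma exists_nbhd_aux {E : Type*} [NormedAddCommGroup E] [ProperSpace E]
    (F : Set E) (hF : IsClosed F) (x : E) (hx : x ∈ F)
    (hb : IsBounded (connectedComponentIn F x)) (N : Set E) (hN : IsOpen N)
    (hVN : connectedComponentIn F x ⊆ N) :
    ∃ D : Set E, IsOpen D ∧ IsBounded D ∧ connectedComponentIn F x ⊆ D ∧ D ⊆ N ∧
      closure D ∩ F ⊆ D := by
  obtain ⟨r, hr⟩ := hb.subset_ball (0 : E)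
  set V := connectedComponentIn F x with hV
  have hxV : x ∈ V := mem_connectedComponentIn hx
  let K : Set E := F ∩ Metric.closedBall 0 r
  have hK : IsCompact K := (isCompact_closedBall 0 r).inter_left hF
  have hVK : V ⊆ K := fun v hv =>
    ⟨connectedComponentIn_subset F x hv, Metric.ball_subset_closedBall (hr hv)⟩
  have : CompactSpace K := isCompact_iff_compactSpace.mp hK
  let x0 : K := ⟨x, hVK hxV⟩
  have hcomp : ∀ y ∈ connectedComponent x0, (y : E) ∈ V := by
    intro y hy
    have h1 : IsPreconnected ((↑) '' connectedComponent x0 : Set E) :=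
      isPreconnected_connectedComponent.image _ continuous_subtype_val.continuousOn
    refine h1.subset_connectedComponentIn ⟨x0, mem_connectedComponent, rfl⟩ ?_ ⟨y, hy, rfl⟩
    rintro _ ⟨z, -, rfl⟩
    exact z.2.1
  have hcomp' : ∀ v (hv : v ∈ V), (⟨v, hVK hv⟩ : K) ∈ connectedComponent x0 := by
    intro v hv
    have h1 : IsPreconnected ((↑) ⁻¹' V : Set K) := by
      rw [← Topology.IsInducing.subtypeVal.isPreconnected_image,
        Subtype.image_preimage_coe, inter_eq_right.mpr hVK]
      exact isPreconnected_connectedComponentIn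
    exact h1.subset_connectedComponent (x := x0) hxV hv
  obtain ⟨A, hA, hxA, hAN⟩ : ∃ A : Set K, IsClopen A ∧ x0 ∈ A ∧
      A ⊆ (↑) ⁻¹' (N ∩ Metric.ball 0 r) := by
    have hop : IsOpen ((↑) ⁻¹' (N ∩ Metric.ball 0 r) : Set K) :=
      (hN.inter Metric.isOpen_ball).preimage continuous_subtype_val
    have : Nonempty { s : Set K // IsClopen s ∧ x0 ∈ s } := ⟨⟨univ, isClopen_univ, trivial⟩⟩
    have := exists_subset_nhds_of_isCompact'
      (V := fun s : { s : Set K // IsClopen s ∧ x0 ∈ s } => (s : Set K))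
      (U := (↑) ⁻¹' (N ∩ Metric.ball 0 r)) ?_ (fun s => s.2.1.isClosed.isCompact)
      (fun s => s.2.1.isClosed) ?_
    · obtain ⟨⟨A, hA1, hA2⟩, h⟩ := this
      exact ⟨A, hA1, hA2, h⟩
    · intro s t
      exact ⟨⟨s ∩ t, s.2.1.inter t.2.1, s.2.2, t.2.2⟩, inter_subset_left, inter_subset_right⟩
    · intro y hy
      rw [← connectedComponent_eq_iInter_isClopen] at hy
      exact hop.mem_nhds ⟨hVN (hcomp y hy), hr (hcomp y hy)⟩
  have hAc : IsCompact ((↑) '' A : Set E) := hA.isClosed.isCompact.image continuous_subtype_val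
  have hAc' : IsCompact ((↑) '' Aᶜ : Set E) :=
    hA.compl.isClosed.isCompact.image continuous_subtype_val
  have hW : IsOpen ((N ∩ Metric.ball 0 r) ∩ ((↑) '' Aᶜ : Set E)ᶜ) :=
    (hN.inter Metric.isOpen_ball).inter hAc'.isClosed.isOpen_compl
  obtain ⟨D, hD, hAD, hDW⟩ := normal_exists_closure_subset hAc.isClosed hW (by
    rintro _ ⟨a, ha, rfl⟩
    refine ⟨hAN ha, ?_⟩
    rintro ⟨b, hb, hba⟩
    exact hb (Subtype.ext hba ▸ ha))
  refine ⟨D, hD, Metric.isBounded_ball.subset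
    (fun z hz => (hDW (subset_closure hz)).1.2), ?_, fun z hz => (hDW (subset_closure hz)).1.1, ?_⟩
  · intro v hv
    exact hAD ⟨⟨v, hVK hv⟩, hA.connectedComponent_subset hxA (hcomp' v hv), rfl⟩
  · rintro z ⟨hz, hzF⟩
    have h := hDW hz
    have hzK : z ∈ K := ⟨hzF, Metric.ball_subset_closedBall h.1.2⟩
    by_cases hzA : (⟨z, hzK⟩ : K) ∈ A
    · exact hAD ⟨_, hzA, rfl⟩
    · exact absurd ⟨_, hzA, rfl⟩ h.2

/-- A preconnected set meeting `s`, on which `s` is relatively clopen, lies in `s`. -/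
lemma subset_of_clopen_aux {X : Type*} [TopologicalSpace X] {C G H : Set X}
    (hC : IsPreconnected C) (hG : IsOpen G) (hH : IsClosed H)
    (hGH : G ⊆ H) (hHG : ∀ z ∈ C, z ∈ H → z ∈ G) (hne : (C ∩ G).Nonempty) : C ⊆ G := by
  intro z hz
  by_contra hzG
  obtain ⟨w, hwC, hwG, hwH⟩ := hC G Hᶜ hG hH.isOpen_compl
    (fun u hu => by
      by_cases h : u ∈ H
      · exact Or.inl (hHG u hu h)
      · exact Or.inr h) hne ⟨z, hz, fun h => hzG (hHG z hz h)⟩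
  exact hwH (hGH hwG)

theorem stmt_5 (d : ℕ) (hd : 2 ≤ d)
    (f : EuclideanSpace ℝ (Fin d) → EuclideanSpace ℝ (Fin d))
    (hf_cont : Continuous f) (hf_open : IsOpenMap f)
    (hf_disc : ∀ y : EuclideanSpace ℝ (Fin d),
      DiscreteTopology ↥(f ⁻¹' {y}))
    (U' : Set (EuclideanSpace ℝ (Fin d)))
    (hU'_open : IsOpen U') (hU'_conn : IsConnected U')
    (U : Set (EuclideanSpace ℝ (Fin d)))
    (hU_comp : ∃ x ∈ f ⁻¹' U', U = connectedComponentIn (f ⁻¹' U') x)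
    (hU_bdd : IsBounded U)
    (V : Set (EuclideanSpace ℝ (Fin d)))
    (hV_comp : ∃ x ∈ Uᶜ, V = connectedComponentIn Uᶜ x)
    (hV_bdd : IsBounded V) :
    (∃ y ∈ U'ᶜ, f '' V = connectedComponentIn U'ᶜ y) ∧ IsBounded (f '' V) := by
  obtain ⟨x0, hx0, hU⟩ := hU_comp
  obtain ⟨x, hx, hV⟩ := hV_comp
  have hUo : IsOpen U := hU ▸ (hU'_open.preimage hf_cont).connectedComponentIn
  have hUU' : ∀ u ∈ U, f u ∈ U' := by
    intro u hu
    rw [hU] at hu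
    exact connectedComponentIn_subset (f ⁻¹' U') x0 hu
  have hVU : V ⊆ Uᶜ := hV ▸ connectedComponentIn_subset _ _
  have hxV : x ∈ V := hV ▸ mem_connectedComponentIn hx
  have hVpre : IsPreconnected V := hV ▸ isPreconnected_connectedComponentIn
  have hVclosed : IsClosed V := by
    have h1 : closure V ⊆ V := by
      have h2 : IsPreconnected (closure V) := hVpre.closure
      have h3 : closure V ⊆ Uᶜ := closure_minimal hVU hUo.isClosed_compl
      have := h2.subset_connectedComponentIn (subset_closure hxV) h3
      rwa [← hV] at this
    exact closure_subset_iff_isClosed.mp h1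
  have hVc : IsCompact V := Metric.isCompact_of_isClosed_isBounded hVclosed hV_bdd
  have hfVc : IsCompact (f '' V) := hVc.image hf_cont
  have nbhd : ∀ N : Set (EuclideanSpace ℝ (Fin d)), IsOpen N → V ⊆ N →
      ∃ D, IsOpen D ∧ V ⊆ D ∧ D ⊆ N ∧ IsCompact (f '' closure D) ∧
        ∀ z ∈ f '' closure D, z ∉ f '' D → z ∈ U' := by
    intro N hN hVN
    obtain ⟨D, h1, h2, h3, h4, h5⟩ := exists_nbhd_aux Uᶜ hUo.isClosed_compl x hx
      (hV ▸ hV_bdd) N hN (hV ▸ hVN)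
    refine ⟨D, h1, hV ▸ h3, h4, h2.isCompact_closure.image hf_cont, ?_⟩
    rintro _ ⟨w, hw, rfl⟩ hwD
    refine hUU' w ?_
    by_contra hwU
    exact hwD ⟨w, h5 ⟨hw, hwU⟩, rfl⟩
  -- points of V that map into the target domain are interior points of V
  have hVinter : ∀ v ∈ V, f v ∈ U' → v ∈ interior V := by
    intro v hv hfv
    have hop : IsOpen (f ⁻¹' U') := hU'_open.preimage hf_cont
    obtain ⟨ε, hε, hball⟩ := Metric.isOpen_iff.mp hop v hfv
    have hbp : IsPreconnected (Metric.ball v ε) := (convex_ball v ε).isPreconnected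
    have hdis : Metric.ball v ε ⊆ Uᶜ := by
      intro w hw hwU
      apply hVU hv
      rw [hU] at hwU ⊢
      rw [connectedComponentIn_eq hwU]
      exact hbp.subset_connectedComponentIn hw hball (Metric.mem_ball_self hε)
    rw [mem_interior]
    refine ⟨_, ?_, Metric.isOpen_ball, Metric.mem_ball_self hε⟩
    have := hbp.subset_connectedComponentIn (Metric.mem_ball_self hε) hdis
    rw [hV] at hv ⊢
    rwa [connectedComponentIn_eq hv]
  have hmaps : f '' V ⊆ U'ᶜ := by
    rintro _ ⟨v, hv, rfl⟩ hfv
    have hsub : U' ⊆ f '' interior V := by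
      refine subset_of_clopen_aux hU'_conn.isPreconnected (hf_open _ isOpen_interior)
        hfVc.isClosed (image_mono interior_subset) ?_ ⟨f v, hfv, v, hVinter v hv hfv, rfl⟩
      rintro _ hz ⟨w, hw, rfl⟩
      exact ⟨w, hVinter w hw hz, rfl⟩
    obtain ⟨D, hDo, hVD, -, hDc, hDf⟩ := nbhd univ isOpen_univ (subset_univ _)
    have huniv : univ ⊆ f '' D := by
      refine subset_of_clopen_aux isPreconnected_univ (hf_open _ hDo) hDc.isClosed
        (image_mono subset_closure) ?_ ⟨f v, trivial, v, hVD hv, rfl⟩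
      intro z _ hz
      by_contra hzD
      exact hzD (image_mono (interior_subset.trans hVD) (hsub (hDf z hz hzD)))
    have : Nonempty (Fin d) := ⟨⟨0, by omega⟩⟩
    have hcu : f '' closure D = univ :=
      eq_univ_of_univ_subset (huniv.trans (image_mono subset_closure))
    rw [hcu] at hDc
    exact noncompact_univ (EuclideanSpace ℝ (Fin d)) hDc
  refine ⟨⟨f x, hmaps ⟨x, hxV, rfl⟩, Subset.antisymm ?_ ?_⟩, hfVc.isBounded⟩
  · exact (hVpre.image f hf_cont.continuousOn).subset_connectedComponentIn ⟨x, hxV, rfl⟩ hmaps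
  · intro y hy
    by_contra hyV
    obtain ⟨D, hDo, hVD, hDN, hDc, hDf⟩ := nbhd (f ⁻¹' {y})ᶜ
      (isClosed_singleton.preimage hf_cont).isOpen_compl
      (fun v hv h => hyV ⟨v, hv, h⟩)
    have hsub : connectedComponentIn U'ᶜ (f x) ⊆ f '' D := by
      refine subset_of_clopen_aux isPreconnected_connectedComponentIn (hf_open _ hDo) hDc.isClosed
        (image_mono subset_closure) ?_
        ⟨f x, mem_connectedComponentIn (hmaps ⟨x, hxV, rfl⟩), x, hVD hxV, rfl⟩
      intro z hzC hz
      by_contra hzD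
      exact connectedComponentIn_subset _ _ hzC (hDf z hz hzD)
    obtain ⟨w, hw, hwy⟩ := hsub hy
    exact hDN hw hwy
end

section
/- Let d ≥ 2 and let f : ℝ^d → ℝ^d be continuous, open and discrete. Let U' ⊆ ℝ^d be a domain and let U be a bounded connected component of f⁻¹(U'). Then cc(U') ≤ cc(U), i.e. the number of connected components of the complement of U' in the one-point compactification of ℝ^d is at most the number of connected components of the complement of U in the one-point compactification of ℝ^d. -/
open Set Bornology

/-- `cc U` is the cardinality of the set of connected components of the complement
of (the image of) `U` in the one-point compactification of `ℝ^d`. -/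
noncomputable def cc {d : ℕ} (U : Set (EuclideanSpace ℝ (Fin d))) : Cardinal :=
  Cardinal.mk (ConnectedComponents ↥((OnePoint.some '' U)ᶜ :
    Set (OnePoint (EuclideanSpace ℝ (Fin d)))))

theorem isPreconnected_compl_closedBall_aux {E : Type*} [NormedAddCommGroup E] [NormedSpace ℝ E]
    (h : 1 < Module.rank ℝ E) {R : ℝ} (hR : 0 ≤ R) :
    IsPreconnected ((Metric.closedBall (0 : E) R)ᶜ) := by
  have h1 : IsPreconnected ({0}ᶜ : Set E) :=
    (isConnected_compl_singleton_of_one_lt_rank h 0).isPreconnected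
  have h2 : ContinuousOn (fun x : E => (1 + R / ‖x‖) • x) ({0}ᶜ : Set E) := by
    refine ContinuousOn.smul (ContinuousOn.add continuousOn_const
      (ContinuousOn.div continuousOn_const continuousOn_id.norm ?_)) continuousOn_id
    intro x hx
    simpa using hx
  have h3 := h1.image _ h2
  convert h3 using 1
  ext y
  simp only [mem_compl_iff, Metric.mem_closedBall, dist_zero_right, not_le, mem_image,
    mem_singleton_iff]
  constructor
  · intro hy
    have hy0 : 0 < ‖y‖ := lt_of_le_of_lt hR hy
    have hd : 0 < ‖y‖ - R := by linarith
    have hs : 0 < 1 - R / ‖y‖ := by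
      rw [sub_pos, div_lt_one hy0]; exact hy
    refine ⟨(1 - R / ‖y‖) • y, ?_, ?_⟩
    · rw [smul_eq_zero]
      rintro (h | h)
      · exact hs.ne' h
      · simp [h] at hy0
    · have : ‖(1 - R / ‖y‖) • y‖ = ‖y‖ - R := by
        rw [norm_smul, Real.norm_of_nonneg hs.le]
        field_simp
      rw [this, smul_smul]
      have : (1 + R / (‖y‖ - R)) * (1 - R / ‖y‖) = 1 := by
        field_simp
        ring
      rw [this, one_smul]
  · rintro ⟨x, hx, rfl⟩
    have hx0 : 0 < ‖x‖ := norm_pos_iff.mpr hx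
    rw [norm_smul, Real.norm_of_nonneg (by positivity)]
    have : (1 + R / ‖x‖) * ‖x‖ = ‖x‖ + R := by field_simp
    linarith

theorem const_of_int_valued_aux {X : Type*} [TopologicalSpace X] {S : Set X}
    (hS : IsPreconnected S) {H : X → ℝ} (hc : ContinuousOn H S)
    (hT : ∀ x ∈ S, ∃ n : ℤ, H x = n) {x y : X} (hx : x ∈ S) (hy : y ∈ S) : H x = H y := by
  haveI : DiscreteTopology ↥(range ((↑) : ℤ → ℝ)) :=
    (Int.isClosedEmbedding_coe_real.toHomeomorph).symm.isEmbedding.discreteTopology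
  exact hS.constant_of_mapsTo (T := range ((↑) : ℤ → ℝ)) ⟨this⟩ hc
    (fun x hx => by obtain ⟨n, hn⟩ := hT x hx; exact ⟨n, hn.symm⟩) hx hy

theorem exists_lift_aux {E : Type*} [NormedAddCommGroup E] [NormedSpace ℝ E]
    {U P Q : Set E} (hU : IsOpen U) (hUc : IsPreconnected U) (hP : IsClosed P) (hQ : IsClosed Q)
    (hPQ : Disjoint P Q) (hfr : frontier U ⊆ P ∪ Q) :
    ∃ H : E → ℝ, Continuous H ∧ (∀ x ∉ U, ∃ n : ℤ, H x = n) ∧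
      ∀ x ∈ frontier U, ∀ y ∈ frontier U, x ∈ P → y ∈ Q → H x ≠ H y := by
  classical
  obtain ⟨G, hG0, hG1, -⟩ := exists_continuous_zero_one_of_isClosed hP hQ hPQ
  have hfrG : ∀ x ∈ frontier U, ((G x : ℝ) : AddCircle (1 : ℝ)) = 0 := by
    intro x hx
    rcases hfr hx with h | h
    · rw [hG0 h]; simp
    · rw [hG1 h]; simpa using AddCircle.coe_period (1 : ℝ)
  let h : E → AddCircle (1 : ℝ) := fun x => if x ∈ closure U then ((G x : ℝ) : AddCircle (1:ℝ)) else 0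
  have hh : Continuous h := by
    refine continuous_if ?_ ?_ continuousOn_const
    · intro a ha
      exact hfrG a (frontier_closure_subset ha)
    · exact ((AddCircle.continuous_mk' (1:ℝ)).comp G.continuous).continuousOn
  obtain ⟨e0, he0⟩ := QuotientAddGroup.mk_surjective (h 0)
  haveI : ContractibleSpace E := RealTopologicalVectorSpace.contractibleSpace
  obtain ⟨H, ⟨-, hH⟩, -⟩ := (AddCircle.isCoveringMap_coe (1 : ℝ)).existsUnique_continuousMap_lifts
    ⟨h, hh⟩ 0 e0 he0
  have hH' : ∀ x, ((H x : ℝ) : AddCircle (1:ℝ)) = h x := fun x => congrFun hH x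
  have hint : ∀ r : ℝ, ((r : ℝ) : AddCircle (1:ℝ)) = 0 → ∃ n : ℤ, r = n := by
    intro r hr
    rw [AddCircle.coe_eq_zero_iff] at hr
    obtain ⟨n, hn⟩ := hr
    exact ⟨n, by simpa using hn.symm⟩
  refine ⟨H, H.continuous, ?_, ?_⟩
  · intro x hx
    apply hint
    rw [hH']
    by_cases hxc : x ∈ closure U
    · simp only [h, if_pos hxc]
      apply hfrG
      rw [hU.frontier_eq]
      exact ⟨hxc, hx⟩
    · simp only [h, if_neg hxc]
  · intro x hx y hy hxP hyQ hxy
    have := const_of_int_valued_aux (S := closure U) hUc.closure (H := fun x => H x - G x)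
      (by fun_prop) (fun z hz => by
        apply hint
        rw [AddCircle.coe_sub, hH']
        simp only [h, if_pos hz, sub_self])
      (frontier_subset_closure hx) (frontier_subset_closure hy)
    simp only [hG0 hxP, hG1 hyQ, hxy, Pi.zero_apply, Pi.one_apply] at this
    linarith

theorem separate_aux {d : ℕ} (hd : 2 ≤ d) {U P Q : Set (EuclideanSpace ℝ (Fin d))}
    (hU : IsOpen U) (hUc : IsPreconnected U) (hb : IsBounded U) (hP : IsClosed P) (hQ : IsClosed Q)
    (hPQ : Disjoint P Q) (hfr : frontier U ⊆ P ∪ Q)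
    (x y : ↥((OnePoint.some '' U)ᶜ : Set (OnePoint (EuclideanSpace ℝ (Fin d)))))
    (a b : EuclideanSpace ℝ (Fin d)) (ha : a ∈ frontier U) (hb' : b ∈ frontier U)
    (haP : a ∈ P) (hbQ : b ∈ Q) (hxa : x.1 = OnePoint.some a) (hyb : y.1 = OnePoint.some b) :
    (x : ConnectedComponents ↥((OnePoint.some '' U)ᶜ : Set (OnePoint (EuclideanSpace ℝ (Fin d))))) ≠ y := by
  intro hxy
  obtain ⟨H, hH, hHi, hHn⟩ := exists_lift_aux hU hUc hP hQ hPQ hfr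
  obtain ⟨R, hR0, hR⟩ := hb.subset_closedBall_lt 0 0
  have hrank : 1 < Module.rank ℝ (EuclideanSpace ℝ (Fin d)) := by
    rw [← Module.finrank_eq_rank, finrank_euclideanSpace_fin]
    exact_mod_cast hd
  have hpre := isPreconnected_compl_closedBall_aux hrank hR0.le
  haveI : Nontrivial (EuclideanSpace ℝ (Fin d)) := by
    apply Module.nontrivial_of_finrank_pos (R := ℝ)
    rw [finrank_euclideanSpace_fin]; omega
  obtain ⟨z0, hz0⟩ : ((Metric.closedBall (0 : EuclideanSpace ℝ (Fin d)) R)ᶜ).Nonempty := by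
    obtain ⟨z, hz⟩ := NormedSpace.exists_lt_norm ℝ (EuclideanSpace ℝ (Fin d)) R
    exact ⟨z, by simpa using hz⟩
  have hconst : ∀ z ∈ (Metric.closedBall (0 : EuclideanSpace ℝ (Fin d)) R)ᶜ, H z = H z0 :=
    fun z hz => const_of_int_valued_aux hpre hH.continuousOn
      (fun w hw => hHi w (fun h => hw (hR h))) hz hz0
  let Φ : OnePoint (EuclideanSpace ℝ (Fin d)) → ℝ := fun z => OnePoint.elim z (H z0) H
  have hΦ : Continuous Φ := by
    rw [continuous_iff_continuousAt]
    intro z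
    induction z using OnePoint.rec with
    | infty =>
      rw [OnePoint.continuousAt_infty']
      apply Filter.Tendsto.congr' (f₁ := fun _ => H z0) _ tendsto_const_nhds
      rw [Filter.coclosedCompact_eq_cocompact]
      filter_upwards [(isCompact_closedBall (0 : EuclideanSpace ℝ (Fin d)) R).compl_mem_cocompact]
        with w hw
      exact (hconst w hw).symm
    | coe w =>
      rw [OnePoint.continuousAt_coe]
      exact hH.continuousAt
  have hy : y ∈ connectedComponent x := by
    rw [← ConnectedComponents.coe_eq_coe.mp hxy.symm]; exact mem_connectedComponent
  have := const_of_int_valued_aux (isPreconnected_connectedComponent (x := x))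
    (H := fun w => Φ w.1) (hΦ.comp continuous_subtype_val).continuousOn
    (fun w _ => by
      obtain ⟨w, hw⟩ := w
      induction w using OnePoint.rec with
      | infty => exact hHi z0 (fun h => hz0 (hR h))
      | coe v => exact hHi v (fun h => hw ⟨v, h, rfl⟩)) mem_connectedComponent hy
  simp only [hxa, hyb] at this
  exact hHn a ha b hb' haP hbQ this

theorem component_meets_aux {d : ℕ} (hd : 2 ≤ d) {U : Set (EuclideanSpace ℝ (Fin d))}
    (hU : IsOpen U) (hne : U.Nonempty) (hb : IsBounded U)
    (x : ↥((OnePoint.some '' U)ᶜ : Set (OnePoint (EuclideanSpace ℝ (Fin d))))) :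
    ∃ a ∈ frontier U, ∃ y : ↥((OnePoint.some '' U)ᶜ : Set (OnePoint (EuclideanSpace ℝ (Fin d)))),
      y.1 = OnePoint.some a ∧ (y : ConnectedComponents ↥((OnePoint.some '' U)ᶜ : Set (OnePoint (EuclideanSpace ℝ (Fin d))))) = x := by
  haveI : Nontrivial (EuclideanSpace ℝ (Fin d)) := by
    apply Module.nontrivial_of_finrank_pos (R := ℝ)
    rw [finrank_euclideanSpace_fin]; omega
  haveI : NoncompactSpace (EuclideanSpace ℝ (Fin d)) := NormedSpace.noncompactSpace ℝ _
  by_contra hcon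
  push Not at hcon
  have hXc : IsClosed ((OnePoint.some '' U)ᶜ : Set (OnePoint (EuclideanSpace ℝ (Fin d)))) :=
    (OnePoint.isOpenEmbedding_coe.isOpenMap U hU).isClosed_compl
  haveI := isCompact_iff_compactSpace.mp hXc.isCompact
  have hcU : IsCompact (closure U) := hb.isCompact_closure
  have hcF : IsCompact (frontier U) := hcU.of_isClosed_subset isClosed_frontier
    frontier_subset_closure
  set F : Set (OnePoint (EuclideanSpace ℝ (Fin d))) := OnePoint.some '' frontier U with hF
  have hFc : IsCompact F := hcF.image OnePoint.continuous_coe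
  set F' : Set ↥((OnePoint.some '' U)ᶜ : Set (OnePoint (EuclideanSpace ℝ (Fin d)))) :=
    Subtype.val ⁻¹' F with hF'
  have hF'c : IsCompact F' := (hFc.isClosed.preimage continuous_subtype_val).isCompact
  have hdisj : F' ∩ connectedComponent x = ∅ := by
    rw [eq_empty_iff_forall_notMem]
    rintro y ⟨⟨a, ha, hay⟩, hy⟩
    exact hcon a ha y hay.symm (ConnectedComponents.coe_eq_coe.mpr
      (connectedComponent_eq hy).symm)
  rw [connectedComponent_eq_iInter_isClopen] at hdisj
  haveI : Nonempty { s : Set ↥((OnePoint.some '' U)ᶜ : Set (OnePoint (EuclideanSpace ℝ (Fin d)))) //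
      IsClopen s ∧ x ∈ s } := ⟨⟨univ, isClopen_univ, mem_univ x⟩⟩
  obtain ⟨V, hV⟩ := hF'c.elim_directed_family_closed
    (fun s : { s : Set _ // IsClopen s ∧ x ∈ s } => s.1)
    (fun s => s.2.1.1) hdisj
    (by
      rintro ⟨s, hs, hxs⟩ ⟨t, ht, hxt⟩
      exact ⟨⟨s ∩ t, hs.inter ht, hxs, hxt⟩, inter_subset_left, inter_subset_right⟩)
  obtain ⟨V, hVc, hxV⟩ := V
  simp only at hV
  have hclosed : IsClosed (Subtype.val '' V) := hXc.isClosedMap_subtype_val _ hVc.1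
  have hopen : IsOpen (Subtype.val '' V) := by
    obtain ⟨O, hO, hOV⟩ := hVc.2
    have : Subtype.val '' V = O ∩ (OnePoint.some '' closure U)ᶜ := by
      ext z
      constructor
      · rintro ⟨y, hy, rfl⟩
        refine ⟨by rw [← hOV] at hy; exact hy, ?_⟩
        rintro ⟨a, ha, hay⟩
        have : y ∈ F' ∩ V := by
          refine ⟨⟨a, ?_, hay⟩, hy⟩
          rw [hU.frontier_eq]
          exact ⟨ha, fun h => y.2 ⟨a, h, hay⟩⟩
        rw [hV] at this
        exact this
      · rintro ⟨hz, hz'⟩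
        refine ⟨⟨z, fun h => hz' (image_mono subset_closure h)⟩, ?_, rfl⟩
        rw [← hOV]; exact hz
    rw [this]
    exact hO.inter (hcU.image OnePoint.continuous_coe).isClosed.isOpen_compl
  have huniv := IsClopen.eq_univ ⟨hclosed, hopen⟩ ⟨x.1, x, hxV, rfl⟩
  obtain ⟨u, hu⟩ := hne
  have : OnePoint.some u ∈ (Subtype.val '' V) := by rw [huniv]; trivial
  obtain ⟨y, -, hy⟩ := this
  exact y.2 ⟨u, hu, hy.symm⟩

theorem stmt_6 (d : ℕ) (hd : 2 ≤ d)
    (f : EuclideanSpace ℝ (Fin d) → EuclideanSpace ℝ (Fin d))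
    (hf_cont : Continuous f) (hf_open : IsOpenMap f)
    (hf_disc : ∀ y : EuclideanSpace ℝ (Fin d),
      DiscreteTopology ↥(f ⁻¹' {y}))
    (U' : Set (EuclideanSpace ℝ (Fin d)))
    (hU'_open : IsOpen U') (hU'_conn : IsConnected U')
    (U : Set (EuclideanSpace ℝ (Fin d)))
    (hU_comp : ∃ x ∈ f ⁻¹' U', U = connectedComponentIn (f ⁻¹' U') x)
    (hU_bdd : IsBounded U) :
    cc U' ≤ cc U := by
  obtain ⟨x0, hx0, hUeq⟩ := hU_comp
  have hpo : IsOpen (f ⁻¹' U') := hU'_open.preimage hf_cont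
  have hUo : IsOpen U := hUeq ▸ hpo.connectedComponentIn
  have hUc : IsPreconnected U := hUeq ▸ isPreconnected_connectedComponentIn
  have hx0U : x0 ∈ U := hUeq ▸ mem_connectedComponentIn hx0
  have hUsub : U ⊆ f ⁻¹' U' := hUeq ▸ connectedComponentIn_subset _ _
  have hcl : ∀ x ∈ closure U, f x ∈ U' → x ∈ U := by
    intro x hx hfx
    have hxc : IsPreconnected (insert x U) :=
      hUc.subset_closure (subset_insert _ _) (insert_subset hx subset_closure)
    have := hxc.subset_connectedComponentIn (x := x0) (F := f ⁻¹' U') (mem_insert_of_mem _ hx0U)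
      (insert_subset hfx hUsub)
    rw [hUeq]
    exact this (mem_insert _ _)
  have hcU : IsCompact (closure U) := hU_bdd.isCompact_closure
  have hfcU : IsCompact (f '' closure U) := hcU.image hf_cont
  have hU'sub : U' ⊆ f '' closure U := by
    have h1 : U' ⊆ f '' U ∪ (f '' closure U)ᶜ := by
      intro y hy
      by_cases h : y ∈ f '' closure U
      · obtain ⟨x, hx, rfl⟩ := h
        exact Or.inl ⟨x, hcl x hx hy, rfl⟩
      · exact Or.inr h
    have h2 := hU'_conn.isPreconnected.subset_left_of_subset_union (hf_open U hUo)
      hfcU.isClosed.isOpen_compl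
      (disjoint_compl_right.mono_left (image_mono subset_closure)) h1
      ⟨f x0, hx0, x0, hx0U, rfl⟩
    exact h2.trans (image_mono subset_closure)
  have hU'b : IsBounded U' := hfcU.isBounded.subset hU'sub
  have hfr : ∀ y ∈ frontier U', ∃ x ∈ frontier U, f x = y := by
    intro y hy
    rw [hU'_open.frontier_eq] at hy
    obtain ⟨x, hx, rfl⟩ := closure_minimal hU'sub hfcU.isClosed hy.1
    refine ⟨x, ?_, rfl⟩
    rw [hUo.frontier_eq]
    exact ⟨hx, fun h => hy.2 (hUsub h)⟩
  have hfr' : ∀ x ∈ frontier U, f x ∉ U' := by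
    intro x hx h
    rw [hUo.frontier_eq] at hx
    exact hx.2 (hcl x hx.1 h)
  have hkey : ∀ C : ConnectedComponents ↥((OnePoint.some '' U')ᶜ :
      Set (OnePoint (EuclideanSpace ℝ (Fin d)))), ∃ a ∈ frontier U,
      ∃ y : ↥((OnePoint.some '' U')ᶜ : Set (OnePoint (EuclideanSpace ℝ (Fin d)))),
      y.1 = OnePoint.some (f a) ∧ (y : ConnectedComponents ↥((OnePoint.some '' U')ᶜ : Set (OnePoint (EuclideanSpace ℝ (Fin d))))) = C := by
    intro C
    obtain ⟨x, rfl⟩ := ConnectedComponents.surjective_coe C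
    obtain ⟨b, hb, y, hy, hyx⟩ := component_meets_aux hd hU'_open hU'_conn.nonempty hU'b x
    obtain ⟨a, ha, rfl⟩ := hfr b hb
    exact ⟨a, ha, y, hy, hyx⟩
  choose a ha y hy hyC using hkey
  have hmem : ∀ C, OnePoint.some (a C) ∈ ((OnePoint.some '' U)ᶜ :
      Set (OnePoint (EuclideanSpace ℝ (Fin d)))) := by
    rintro C ⟨u, hu, huC⟩
    have := ha C
    rw [hUo.frontier_eq] at this
    exact this.2 (OnePoint.coe_injective huC ▸ hu)
  have hXc : IsClosed ((OnePoint.some '' U')ᶜ : Set (OnePoint (EuclideanSpace ℝ (Fin d)))) :=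
    (OnePoint.isOpenEmbedding_coe.isOpenMap U' hU'_open).isClosed_compl
  haveI := isCompact_iff_compactSpace.mp hXc.isCompact
  unfold cc
  refine Cardinal.mk_le_of_injective
    (f := fun C => ((⟨OnePoint.some (a C), hmem C⟩ :
      ↥((OnePoint.some '' U)ᶜ : Set (OnePoint (EuclideanSpace ℝ (Fin d))))) :
      ConnectedComponents ↥((OnePoint.some '' U)ᶜ : Set (OnePoint (EuclideanSpace ℝ (Fin d)))))) ?_
  intro C D hCD
  by_contra hne
  have hnot : y D ∉ connectedComponent (y C) := by
    intro h
    apply hne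
    rw [← hyC C, ← hyC D]
    exact ConnectedComponents.coe_eq_coe.mpr (connectedComponent_eq h)
  rw [connectedComponent_eq_iInter_isClopen] at hnot
  simp only [mem_iInter, not_forall] at hnot
  obtain ⟨⟨V, hVc, hCV⟩, hDV⟩ := hnot
  have hemb := hXc.isClosedMap_subtype_val
  have hc : Continuous (fun x => (OnePoint.some (f x) : OnePoint (EuclideanSpace ℝ (Fin d)))) :=
    OnePoint.continuous_coe.comp hf_cont
  refine separate_aux hd hUo hUc hU_bdd
    (P := (fun x => (OnePoint.some (f x) : OnePoint (EuclideanSpace ℝ (Fin d)))) ⁻¹'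
      (Subtype.val '' V))
    (Q := (fun x => (OnePoint.some (f x) : OnePoint (EuclideanSpace ℝ (Fin d)))) ⁻¹'
      (Subtype.val '' Vᶜ))
    ((hemb _ hVc.1).preimage hc) ((hemb _ hVc.compl.1).preimage hc) ?_ ?_ _ _
    (a C) (a D) (ha C) (ha D) ⟨y C, hCV, hy C⟩ ⟨y D, hDV, hy D⟩ rfl rfl hCD
  · exact Disjoint.preimage _ ((disjoint_image_iff Subtype.val_injective).mpr disjoint_compl_right)
  · intro x hx
    have hx' : OnePoint.some (f x) ∈ ((OnePoint.some '' U')ᶜ :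
        Set (OnePoint (EuclideanSpace ℝ (Fin d)))) := by
      rintro ⟨u, hu, hux⟩
      exact hfr' x hx (OnePoint.coe_injective hux ▸ hu)
    by_cases h : (⟨_, hx'⟩ : ↥((OnePoint.some '' U')ᶜ :
        Set (OnePoint (EuclideanSpace ℝ (Fin d))))) ∈ V
    · exact Or.inl ⟨_, h, rfl⟩
    · exact Or.inr ⟨_, h, rfl⟩
end

section
/- Let d ≥ 2 and let f : ℝ^d → ℝ^d be continuous, open and discrete. Let U' ⊆ ℝ^d be a domain and let U be a bounded connected component of f⁻¹(U'). If the complement of U in the one-point compactification of ℝ^d has infinitely many connected components, then so does the complement of U' in the one-point compactification of ℝ^d. -/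
open Set Bornology

/-- A component of the complement of an open set that lies in the image of an open set `O` of `E`
has a compact relatively clopen neighbourhood inside `O`. -/
lemma clopen_nbhd {E : Type*} [TopologicalSpace E] [T2Space E] [LocallyCompactSpace E]
    {U : Set E} (hU : IsOpen U) (a : ↥((OnePoint.some '' U)ᶜ : Set (OnePoint E)))
    {O : Set E} (hO : IsOpen O)
    (h : ∀ z ∈ connectedComponent a, ∃ x ∈ O, (z : OnePoint E) = OnePoint.some x) :
    ∃ W : Set E, IsOpen W ∧ IsCompact (W \ U) ∧ W \ U ⊆ O ∧
      ∀ z ∈ connectedComponent a, ∀ x : E, (z : OnePoint E) = OnePoint.some x → x ∈ W \ U := by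
  have hA : IsClosed ((OnePoint.some '' U)ᶜ : Set (OnePoint E)) := by
    rw [isClosed_compl_iff]; exact OnePoint.isOpen_image_coe.2 hU
  have : CompactSpace ↥((OnePoint.some '' U)ᶜ : Set (OnePoint E)) :=
    isCompact_iff_compactSpace.1 hA.isCompact
  obtain ⟨⟨C, hC, haC⟩, hCO⟩ : ∃ i : { s : Set ↥((OnePoint.some '' U)ᶜ : Set (OnePoint E)) //
      IsClopen s ∧ a ∈ s }, i.1 ⊆ Subtype.val ⁻¹' (OnePoint.some '' O) := by
    have : Nonempty { s : Set ↥((OnePoint.some '' U)ᶜ : Set (OnePoint E)) //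
      IsClopen s ∧ a ∈ s } := ⟨⟨univ, isClopen_univ, mem_univ _⟩⟩
    refine exists_subset_nhds_of_compactSpace (V := fun i : { s : Set ↥((OnePoint.some '' U)ᶜ :
      Set (OnePoint E)) // IsClopen s ∧ a ∈ s } => i.1) ?_ (fun i => i.2.1.isClosed) ?_
    · rintro ⟨s, hs, has⟩ ⟨t, ht, hat⟩
      exact ⟨⟨s ∩ t, hs.inter ht, has, hat⟩, inter_subset_left, inter_subset_right⟩
    · intro x hx
      rw [← connectedComponent_eq_iInter_isClopen] at hx
      refine IsOpen.mem_nhds ((OnePoint.isOpen_image_coe.2 hO).preimage continuous_subtype_val) ?_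
      obtain ⟨y, hy, hxy⟩ := h x hx
      exact ⟨y, hy, hxy.symm⟩
  simp only at hCO
  obtain ⟨W', hW', hWC⟩ := isOpen_induced_iff.1 hC.isOpen
  have key : ∀ x : E, x ∈ OnePoint.some ⁻¹' W' \ U ↔
      ∃ z ∈ C, (z : OnePoint E) = OnePoint.some x := by
    intro x
    constructor
    · rintro ⟨h1, h2⟩
      refine ⟨⟨OnePoint.some x, ?_⟩, ?_, rfl⟩
      · rintro ⟨y, hy, hyx⟩
        exact h2 (OnePoint.coe_injective hyx ▸ hy)
      · rw [← hWC]; exact h1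
    · rintro ⟨z, hz, hzx⟩
      rw [← hWC] at hz
      refine ⟨?_, fun hx => z.2 ⟨x, hx, hzx.symm⟩⟩
      rw [mem_preimage, ← hzx]; exact hz
  have himg : OnePoint.some '' (OnePoint.some ⁻¹' W' \ U) = Subtype.val '' C := by
    ext p
    constructor
    · rintro ⟨x, hx, rfl⟩
      obtain ⟨z, hz, hzx⟩ := (key x).1 hx
      exact ⟨z, hz, hzx⟩
    · rintro ⟨z, hz, rfl⟩
      obtain ⟨x, hx, hzx⟩ := hCO hz
      exact ⟨x, (key x).2 ⟨z, hz, hzx.symm⟩, hzx⟩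
  refine ⟨OnePoint.some ⁻¹' W', hW'.preimage OnePoint.continuous_coe, ?_, ?_, ?_⟩
  · have h1 : IsCompact (Subtype.val '' C) := hC.isClosed.isCompact.image continuous_subtype_val
    rw [← himg] at h1
    exact (OnePoint.isClosed_image_coe.1 h1.isClosed).2
  · intro x hx
    obtain ⟨z, hz, hzx⟩ := (key x).1 hx
    obtain ⟨y, hy, hzy⟩ := hCO hz
    rw [hzx] at hzy
    exact OnePoint.coe_injective hzy ▸ hy
  · intro z hz x hzx
    exact (key x).2 ⟨z, hC.connectedComponent_subset haC hz, hzx⟩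

/-- Bounded complementary components of a bounded set stay in a ball around the set. -/
lemma ray_lemma {E : Type*} [NormedAddCommGroup E] [NormedSpace ℝ E] [ProperSpace E]
    {U : Set E} {R : ℝ} (hR : 0 ≤ R) (hU : U ⊆ Metric.closedBall 0 R)
    (a z : ↥((OnePoint.some '' U)ᶜ : Set (OnePoint E))) (hz : z ∈ connectedComponent a)
    (hinf : ∀ w ∈ connectedComponent a, (w : OnePoint E) ≠ OnePoint.infty)
    (x : E) (hzx : (z : OnePoint E) = OnePoint.some x) : x ∈ Metric.closedBall 0 R := by
  by_contra hx
  rw [mem_closedBall_zero_iff, not_le] at hx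
  set S : Set (OnePoint E) := (fun t : ℝ => OnePoint.some (t • x)) '' Ici 1 with hS
  have hSp : IsPreconnected S := by
    refine isPreconnected_Ici.image _ (Continuous.continuousOn ?_)
    exact OnePoint.continuous_coe.comp (by fun_prop)
  have hcl : OnePoint.infty ∈ closure S := by
    have ht : Filter.Tendsto (fun t : ℝ => (OnePoint.some (t • x) : OnePoint E)) Filter.atTop
        (nhds OnePoint.infty) := by
      have h2 : Filter.Tendsto (fun t : ℝ => t • x) Filter.atTop (Filter.coclosedCompact E) := by
        rw [Filter.coclosedCompact_eq_cocompact, ← Metric.cobounded_eq_cocompact,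
          ← tendsto_norm_atTop_iff_cobounded]
        simp only [norm_smul]
        exact Filter.Tendsto.atTop_mul_const (lt_of_le_of_lt hR hx) tendsto_norm_atTop_atTop
      exact OnePoint.tendsto_coe_infty.comp h2
    refine mem_closure_of_tendsto ht ?_
    filter_upwards [Filter.eventually_ge_atTop 1] with t ht1
    exact ⟨t, ht1, rfl⟩
  have hT : IsPreconnected (insert OnePoint.infty S) :=
    hSp.subset_closure (subset_insert _ _) (insert_subset hcl subset_closure)
  have hTA : insert OnePoint.infty S ⊆ ((OnePoint.some '' U)ᶜ : Set (OnePoint E)) := by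
    rintro p (rfl | ⟨t, ht, rfl⟩)
    · exact OnePoint.infty_notMem_image_coe
    · rintro ⟨u, hu, hut⟩
      have : u = t • x := OnePoint.coe_injective hut
      have h3 := hU hu
      rw [mem_closedBall_zero_iff, this, norm_smul, Real.norm_eq_abs,
        abs_of_nonneg (le_trans zero_le_one ht)] at h3
      have : 1 ≤ t := ht
      nlinarith [norm_nonneg x]
  have hzS : (z : OnePoint E) ∈ insert OnePoint.infty S := by
    right; exact ⟨1, self_mem_Ici, by simp [hzx]⟩
  have h4 := hT.subset_connectedComponentIn hzS hTA (mem_insert _ _)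
  rw [connectedComponentIn_eq_image z.2] at h4
  obtain ⟨w, hw, hw2⟩ := h4
  rw [← connectedComponent_eq hz] at hw
  exact hinf w hw hw2

theorem stmt_7 (d : ℕ) (hd : 2 ≤ d)
    (f : EuclideanSpace ℝ (Fin d) → EuclideanSpace ℝ (Fin d))
    (hf_cont : Continuous f) (hf_open : IsOpenMap f)
    (hf_disc : ∀ y : EuclideanSpace ℝ (Fin d),
      DiscreteTopology ↥(f ⁻¹' {y}))
    (U' : Set (EuclideanSpace ℝ (Fin d)))
    (hU'_open : IsOpen U') (hU'_conn : IsConnected U')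
    (U : Set (EuclideanSpace ℝ (Fin d)))
    (hU_comp : ∃ x ∈ f ⁻¹' U', U = connectedComponentIn (f ⁻¹' U') x)
    (hU_bdd : IsBounded U)
    (h_inf : Infinite (ConnectedComponents ↥((OnePoint.some '' U)ᶜ :
      Set (OnePoint (EuclideanSpace ℝ (Fin d)))))) :
    Infinite (ConnectedComponents ↥((OnePoint.some '' U')ᶜ :
      Set (OnePoint (EuclideanSpace ℝ (Fin d))))) := by
  by_contra hfin
  rw [not_infinite_iff_finite] at hfin
  have : Nonempty (Fin d) := ⟨⟨0, by omega⟩⟩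
  have hpre : IsOpen (f ⁻¹' U') := hU'_open.preimage hf_cont
  obtain ⟨u, hu, hUu⟩ := hU_comp
  have hU_open : IsOpen U := hUu ▸ hpre.connectedComponentIn
  have hUU' : U ⊆ f ⁻¹' U' := hUu ▸ connectedComponentIn_subset _ _
  have hdiff : IsOpen (f ⁻¹' U' \ U) := by
    rw [isOpen_iff_mem_nhds]
    rintro x ⟨hx, hxU⟩
    refine Filter.mem_of_superset (hpre.connectedComponentIn.mem_nhds
      (mem_connectedComponentIn hx)) ?_
    intro y hy
    refine ⟨connectedComponentIn_subset _ _ hy, fun hyU => hxU ?_⟩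
    rw [hUu] at hyU ⊢
    rw [connectedComponentIn_eq hyU, ← connectedComponentIn_eq hy]
    exact mem_connectedComponentIn hx
  obtain ⟨R, hR0, hR⟩ : ∃ R : ℝ, 0 ≤ R ∧ U ⊆ Metric.closedBall 0 R := by
    obtain ⟨R, hR⟩ := hU_bdd.subset_closedBall 0
    exact ⟨max R 0, le_max_right _ _, hR.trans (Metric.closedBall_subset_closedBall (le_max_left _ _))⟩
  -- representatives of the components downstairs
  let r : ConnectedComponents ↥((OnePoint.some '' U')ᶜ :
      Set (OnePoint (EuclideanSpace ℝ (Fin d)))) → OnePoint (EuclideanSpace ℝ (Fin d)) :=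
    fun c => (Quotient.out c).1
  let P : Set (EuclideanSpace ℝ (Fin d)) :=
    ⋃ c, {x | x ∈ Metric.closedBall 0 R ∧ OnePoint.some (f x) = r c}
  have hP : P.Finite := by
    refine finite_iUnion fun c => ?_
    rcases hc : r c with _ | y
    · refine Set.finite_empty.subset ?_
      rintro x ⟨_, hx⟩
      exact OnePoint.coe_ne_infty _ hx
    · have h1 : IsCompact (Metric.closedBall 0 R ∩ f ⁻¹' {y}) :=
        (isCompact_closedBall _ _).inter_right (isClosed_singleton.preimage hf_cont)
      have h2 : IsDiscrete (f ⁻¹' {y}) := ⟨hf_disc y⟩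
      refine (h1.finite (h2.mono inter_subset_right)).subset ?_
      rintro x ⟨hx, hxy⟩
      exact ⟨hx, OnePoint.coe_injective hxy⟩
  have hQ : (insert OnePoint.infty (OnePoint.some '' P) :
      Set (OnePoint (EuclideanSpace ℝ (Fin d)))).Finite := (hP.image _).insert _
  have hQ' : ((Subtype.val : ↥((OnePoint.some '' U)ᶜ :
      Set (OnePoint (EuclideanSpace ℝ (Fin d)))) → _) ⁻¹'
      (insert OnePoint.infty (OnePoint.some '' P))).Finite :=
    hQ.preimage Subtype.val_injective.injOn
  refine h_inf.not_finite ?_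
  rw [← Set.finite_univ_iff]
  refine (hQ'.image ConnectedComponents.mk).subset ?_
  rintro c -
  obtain ⟨a, rfl⟩ := ConnectedComponents.surjective_coe c
  suffices h : ∃ q ∈ connectedComponent a, (q : OnePoint (EuclideanSpace ℝ (Fin d))) ∈
      insert OnePoint.infty (OnePoint.some '' P) by
    obtain ⟨q, hq, hqQ⟩ := h
    exact ⟨q, hqQ, ConnectedComponents.coe_eq_coe'.2 hq⟩
  by_contra hcon
  push Not at hcon
  have hne : ∀ w ∈ connectedComponent a,
      (w : OnePoint (EuclideanSpace ℝ (Fin d))) ≠ OnePoint.infty :=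
    fun w hw hw' => hcon w hw (Or.inl hw')
  have hball := fun z hz => ray_lemma hR0 hR a z hz hne
  -- some point of the component is not mapped into `U'`
  obtain ⟨z0, hz0, x0, hzx0, hx0⟩ : ∃ z0 ∈ connectedComponent a, ∃ x0,
      (z0 : OnePoint (EuclideanSpace ℝ (Fin d))) = OnePoint.some x0 ∧ f x0 ∉ U' := by
    by_contra! hall
    obtain ⟨W, hW, hWc, hWO, hWa⟩ := clopen_nbhd hU_open a hdiff (by
      intro z hz
      obtain ⟨x, hx⟩ := OnePoint.ne_infty_iff_exists.1 (hne z hz)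
      exact ⟨x, ⟨hall z hz x hx.symm, fun hxU => z.2 ⟨x, hxU, hx⟩⟩, hx.symm⟩)
    have hopen : IsOpen (W \ U) := by
      have : W \ U = W ∩ (f ⁻¹' U' \ U) := by
        ext x
        exact ⟨fun hx => ⟨hx.1, hWO hx⟩, fun hx => ⟨hx.1, hx.2.2⟩⟩
      rw [this]; exact hW.inter hdiff
    obtain ⟨x, hx⟩ := OnePoint.ne_infty_iff_exists.1 (hne a mem_connectedComponent)
    have huniv := IsClopen.eq_univ ⟨hWc.isClosed, hopen⟩ ⟨x, hWa a mem_connectedComponent x hx.symm⟩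
    rw [huniv] at hWc
    exact noncompact_univ _ hWc
  have hbA : OnePoint.some (f x0) ∈ ((OnePoint.some '' U')ᶜ :
      Set (OnePoint (EuclideanSpace ℝ (Fin d)))) := by
    rintro ⟨y, hy, hyx⟩
    exact hx0 (OnePoint.coe_injective hyx ▸ hy)
  set b : ↥((OnePoint.some '' U')ᶜ : Set (OnePoint (EuclideanSpace ℝ (Fin d)))) :=
    ⟨OnePoint.some (f x0), hbA⟩ with hb
  set q := Quotient.out (ConnectedComponents.mk b) with hq
  have hqb : q ∈ connectedComponent b := by
    rw [← ConnectedComponents.coe_eq_coe']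
    exact Quotient.out_eq _
  have hOcl : IsClosed {x : EuclideanSpace ℝ (Fin d) | OnePoint.some (f x) = q.1} :=
    isClosed_singleton.preimage (OnePoint.continuous_coe.comp hf_cont)
  obtain ⟨W, hW, hWc, hWO, hWa⟩ := clopen_nbhd hU_open a hOcl.isOpen_compl (by
    intro z hz
    obtain ⟨x, hx⟩ := OnePoint.ne_infty_iff_exists.1 (hne z hz)
    refine ⟨x, fun hxq => hcon z hz (Or.inr ⟨x, ?_, hx⟩), hx.symm⟩
    exact mem_iUnion.2 ⟨ConnectedComponents.mk b, hball z hz x hx.symm, hxq⟩)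
  -- the image of `W \ U` is relatively clopen in the complement of `U'`
  have hclopen : IsClopen ((Subtype.val : ↥((OnePoint.some '' U')ᶜ :
      Set (OnePoint (EuclideanSpace ℝ (Fin d)))) → _) ⁻¹' (OnePoint.some '' (f '' (W \ U)))) := by
    constructor
    · exact (OnePoint.isClosed_image_coe.2 ⟨(hWc.image hf_cont).isClosed,
        hWc.image hf_cont⟩).preimage continuous_subtype_val
    · have : (Subtype.val : ↥((OnePoint.some '' U')ᶜ :
          Set (OnePoint (EuclideanSpace ℝ (Fin d)))) → _) ⁻¹' (OnePoint.some '' (f '' (W \ U)))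
          = Subtype.val ⁻¹' (OnePoint.some '' (f '' W)) := by
        ext p
        constructor
        · rintro ⟨_, ⟨x, hx, rfl⟩, hp⟩
          exact ⟨_, ⟨x, hx.1, rfl⟩, hp⟩
        · rintro ⟨_, ⟨x, hx, rfl⟩, hp⟩
          exact ⟨_, ⟨x, ⟨hx, fun hxU => p.2 ⟨f x, hUU' hxU, hp⟩⟩, rfl⟩, hp⟩
      rw [this]
      exact (OnePoint.isOpen_image_coe.2 (hf_open _ hW)).preimage continuous_subtype_val
  have hbmem : b ∈ ((Subtype.val : ↥((OnePoint.some '' U')ᶜ :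
      Set (OnePoint (EuclideanSpace ℝ (Fin d)))) → _) ⁻¹' (OnePoint.some '' (f '' (W \ U)))) :=
    ⟨f x0, ⟨x0, hWa z0 hz0 x0 hzx0, rfl⟩, rfl⟩
  obtain ⟨_, ⟨x, hx, rfl⟩, hxq⟩ := hclopen.connectedComponent_subset hbmem hqb
  exact hWO hx hxq
end

section
/- Let d ≥ 2, let f : ℝ^d → ℝ^d be a continuous open map, and let U ⊆ ℝ^d be a bounded open set. Then f(hull(U)) ⊆ hull(f(U)). -/
open Set Bornology

theorem exists_open_aux {d : ℕ} (F : Set (EuclideanSpace ℝ (Fin d))) (hF : IsClosed F)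
    (x : EuclideanSpace ℝ (Fin d)) (hx : x ∈ F)
    (hb : IsBounded (connectedComponentIn F x)) :
    ∃ V : Set (EuclideanSpace ℝ (Fin d)), IsOpen V ∧ x ∈ V ∧ IsCompact (F ∩ V) := by
  obtain ⟨R, hR⟩ := hb.subset_ball 0
  have hK : IsCompact (F ∩ Metric.closedBall 0 R) :=
    (isCompact_closedBall 0 R).inter_left hF
  have hxR : x ∈ Metric.ball (0 : EuclideanSpace ℝ (Fin d)) R := hR (mem_connectedComponentIn hx)
  let x' : ↥(F ∩ Metric.closedBall 0 R) := ⟨x, hx, Metric.ball_subset_closedBall hxR⟩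
  have : CompactSpace ↥(F ∩ Metric.closedBall 0 R) := isCompact_iff_compactSpace.mp hK
  have hcomp : connectedComponent x' ⊆ Subtype.val ⁻¹' Metric.ball 0 R := by
    rw [← image_subset_iff]
    refine Subset.trans ?_ hR
    refine IsPreconnected.subset_connectedComponentIn
      (isPreconnected_connectedComponent.image _ continuous_subtype_val.continuousOn)
      ⟨x', mem_connectedComponent, rfl⟩ ?_
    rintro _ ⟨y, -, rfl⟩
    exact y.2.1
  have hZ : ∃ Z : Set ↥(F ∩ Metric.closedBall 0 R), IsClopen Z ∧ x' ∈ Z ∧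
      Z ⊆ Subtype.val ⁻¹' Metric.ball 0 R := by
    rw [connectedComponent_eq_iInter_isClopen] at hcomp
    have : Nonempty { s : Set ↥(F ∩ Metric.closedBall 0 R) // IsClopen s ∧ x' ∈ s } :=
      ⟨⟨univ, isClopen_univ, mem_univ _⟩⟩
    obtain ⟨Z, hZ⟩ := exists_subset_nhds_of_compactSpace
      (V := fun s : { s : Set ↥(F ∩ Metric.closedBall 0 R) // IsClopen s ∧ x' ∈ s } => s.1)
      (fun a b => ⟨⟨a.1 ∩ b.1, a.2.1.inter b.2.1, a.2.2, b.2.2⟩,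
        inter_subset_left, inter_subset_right⟩)
      (fun s => s.2.1.1)
      (U := Subtype.val ⁻¹' Metric.ball 0 R)
      (fun y hy => (Metric.isOpen_ball.preimage continuous_subtype_val).mem_nhds (hcomp hy))
    exact ⟨Z.1, Z.2.1, Z.2.2, hZ⟩
  obtain ⟨Z, hZc, hxZ, hZb⟩ := hZ
  obtain ⟨W, hW, rfl⟩ := isOpen_induced_iff.mp hZc.2
  refine ⟨W ∩ Metric.ball 0 R, hW.inter Metric.isOpen_ball, ⟨hxZ, hxR⟩, ?_⟩
  convert hZc.1.isCompact.image continuous_subtype_val using 1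
  ext y
  constructor
  · rintro ⟨h1, h2, h3⟩
    exact ⟨⟨y, h1, Metric.ball_subset_closedBall h3⟩, h2, rfl⟩
  · rintro ⟨z, hz, rfl⟩
    exact ⟨z.2.1, hz, hZb hz⟩

theorem stmt_9 (d : ℕ) (hd : 2 ≤ d)
    (f : EuclideanSpace ℝ (Fin d) → EuclideanSpace ℝ (Fin d))
    (hf_cont : Continuous f) (hf_open : IsOpenMap f)
    (U : Set (EuclideanSpace ℝ (Fin d)))
    (hU_open : IsOpen U) (hU_bdd : IsBounded U) :
    f '' hull U ⊆ hull (f '' U) := by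
  rintro _ ⟨x, hx, rfl⟩
  by_cases hy : f x ∈ f '' U
  · exact Or.inl hy
  refine Or.inr ⟨hy, ?_⟩
  rcases hx with hx | ⟨hxU, hb⟩
  · exact absurd ⟨x, hx, rfl⟩ hy
  set C := connectedComponentIn (f '' U)ᶜ (f x) with hC
  have hxC : f x ∈ C := mem_connectedComponentIn hy
  have hCc : IsClosed C := by
    refine isClosed_of_closure_subset ?_
    exact IsPreconnected.subset_connectedComponentIn
      isPreconnected_connectedComponentIn.closure (subset_closure hxC)
      (closure_minimal (connectedComponentIn_subset _ _) (hf_open U hU_open).isClosed_compl)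
  have hFU : f ⁻¹' C ⊆ Uᶜ := fun z hz hzU =>
    connectedComponentIn_subset _ _ hz ⟨z, hzU, rfl⟩
  obtain ⟨V, hV, hxV, hcpt⟩ := exists_open_aux (f ⁻¹' C) (hCc.preimage hf_cont) x hxC
    (hb.subset (connectedComponentIn_mono x hFU))
  have him : IsCompact (f '' (f ⁻¹' C ∩ V)) := hcpt.image hf_cont
  have heq : f '' (f ⁻¹' C ∩ V) = C ∩ f '' V := by
    rw [inter_comm, image_inter_preimage, inter_comm]
  rw [heq] at him
  have hpre : IsPreconnected C := isPreconnected_connectedComponentIn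
  -- `C ∩ f '' V` is clopen in `C`
  have hsub : C ⊆ C ∩ f '' V := by
    by_contra hne
    obtain ⟨z, hz, hz'⟩ := not_subset.mp hne
    obtain ⟨w, hw, hw1, hw2⟩ := hpre (f '' V) (C ∩ f '' V)ᶜ (hf_open V hV)
      him.isClosed.isOpen_compl
      (fun w hw => by
        by_cases h : w ∈ f '' V
        · exact Or.inl h
        · exact Or.inr fun h' => h h'.2)
      ⟨f x, hxC, x, hxV, rfl⟩ ⟨z, hz, hz'⟩
    exact hw2 ⟨hw, hw1⟩
  exact him.isBounded.subset hsub
end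

section
/- Let d ≥ 2, let f : ℝ^d → ℝ^d be a continuous open map, and let U ⊆ ℝ^d be a bounded open set. Then ∂ hull(f(U)) ⊆ f(∂ hull(U)), where ∂ denotes the topological frontier in ℝ^d. -/
open Set Bornology

/-- A bounded component of the complement of an open set `W` has a compact
neighbourhood in the complement. -/
lemma exists_compact_nbhd {d : ℕ} (W : Set (EuclideanSpace ℝ (Fin d))) (hW : IsOpen W)
    (x : EuclideanSpace ℝ (Fin d)) (hx : x ∉ W)
    (hb : IsBounded (connectedComponentIn Wᶜ x)) :
    ∃ N : Set (EuclideanSpace ℝ (Fin d)), IsCompact N ∧ x ∈ N ∧ N ⊆ Wᶜ ∧ IsOpen (N ∪ W) := by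
  obtain ⟨R, hR⟩ := hb.subset_ball 0
  have hxR : x ∈ Metric.ball 0 R := hR (mem_connectedComponentIn hx)
  let L : Set (EuclideanSpace ℝ (Fin d)) := Wᶜ ∩ Metric.closedBall 0 R
  have hL : IsCompact L := (isCompact_closedBall 0 R).inter_left hW.isClosed_compl
  have : CompactSpace L := isCompact_iff_compactSpace.mp hL
  have hxL : x ∈ L := ⟨hx, Metric.ball_subset_closedBall hxR⟩
  let p : L := ⟨x, hxL⟩
  have hsub : connectedComponent p ⊆ Subtype.val ⁻¹' Metric.ball 0 R := by
    intro q hq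
    apply hR
    have h1 : IsPreconnected ((Subtype.val : L → _) '' connectedComponent p) :=
      isPreconnected_connectedComponent.image _ continuous_subtype_val.continuousOn
    refine h1.subset_connectedComponentIn ⟨p, mem_connectedComponent, rfl⟩ ?_ ⟨q, hq, rfl⟩
    rintro _ ⟨r, -, rfl⟩
    exact r.2.1
  have hopen : IsOpen ((Subtype.val : L → _) ⁻¹' Metric.ball 0 R) :=
    Metric.isOpen_ball.preimage continuous_subtype_val
  rw [connectedComponent_eq_iInter_isClopen] at hsub
  have : Nonempty { s : Set L // IsClopen s ∧ p ∈ s } := ⟨⟨univ, isClopen_univ, trivial⟩⟩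
  obtain ⟨⟨N, hN, hpN⟩, hNs⟩ := exists_subset_nhds_of_compactSpace
    (V := fun s : { s : Set L // IsClopen s ∧ p ∈ s } => (s : Set L))
    (by
      intro a b
      exact ⟨⟨a.1 ∩ b.1, a.2.1.inter b.2.1, a.2.2, b.2.2⟩, inter_subset_left,
        inter_subset_right⟩)
    (fun s => s.2.1.1) (fun q hq => hopen.mem_nhds (hsub hq))
  obtain ⟨O, hO, hON⟩ := isOpen_induced_iff.mp hN.2
  refine ⟨Subtype.val '' N, hN.1.isCompact.image continuous_subtype_val, ⟨p, hpN, rfl⟩, ?_, ?_⟩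
  · rintro _ ⟨r, -, rfl⟩
    exact r.2.1
  · have : Subtype.val '' N ∪ W = (O ∩ Metric.ball 0 R) ∪ W := by
      ext z
      by_cases hz : z ∈ W
      · simp [hz]
      · simp only [mem_union, hz, or_false]
        constructor
        · rintro ⟨r, hr, rfl⟩
          exact ⟨by rw [← hON] at hr; exact hr, hNs hr⟩
        · rintro ⟨h1, h2⟩
          refine ⟨⟨z, hz, Metric.ball_subset_closedBall h2⟩, ?_, rfl⟩
          rw [← hON]; exact h1
    rw [this]
    exact (hO.inter Metric.isOpen_ball).union hW

/-- A preconnected subset of the complement of `W` meeting a clopen compact piece `N`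
lies in it. -/
lemma subset_of_clopen_piece {X : Type*} [TopologicalSpace X] {C N G : Set X}
    (hC : IsPreconnected C) (hN : IsClosed N) (hG : IsOpen G) (hCG : C ∩ G = C ∩ N)
    (hne : (C ∩ N).Nonempty) : C ⊆ N := by
  by_contra hnot
  obtain ⟨z, hzC, hzN⟩ := not_subset.mp hnot
  have hkey : ∀ w ∈ C, (w ∈ G ↔ w ∈ N) := fun w hw => by
    have := Set.ext_iff.mp hCG w
    simpa [hw] using this
  obtain ⟨y, hyC, hyN⟩ := hne
  obtain ⟨w, hwC, hwG, hwN⟩ := hC G Nᶜ hG hN.isOpen_compl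
    (fun w hw => by
      by_cases h : w ∈ N
      · exact Or.inl ((hkey w hw).2 h)
      · exact Or.inr h)
    ⟨y, hyC, (hkey y hyC).2 hyN⟩ ⟨z, hzC, hzN⟩
  exact hwN ((hkey w hwC).1 hwG)

/-- The hull of an open set is open. -/
lemma isOpen_hull {d : ℕ} (W : Set (EuclideanSpace ℝ (Fin d))) (hW : IsOpen W) :
    IsOpen (hull W) := by
  rw [isOpen_iff_mem_nhds]
  rintro x (hx | ⟨hx, hb⟩)
  · exact Filter.mem_of_superset (hW.mem_nhds hx) subset_union_left
  obtain ⟨N, hN, hxN, hNW, hop⟩ := exists_compact_nbhd W hW x hx hb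
  refine Filter.mem_of_superset (hop.mem_nhds (Or.inl hxN)) ?_
  rintro z (hz | hz)
  · refine Or.inr ⟨hNW hz, hN.isBounded.subset ?_⟩
    refine subset_of_clopen_piece isPreconnected_connectedComponentIn hN.isClosed hop ?_
      ⟨z, mem_connectedComponentIn (hNW hz), hz⟩
    ext w
    constructor
    · rintro ⟨h1, h2 | h2⟩
      · exact ⟨h1, h2⟩
      · exact absurd h2 (connectedComponentIn_subset _ _ h1)
    · rintro ⟨h1, h2⟩
      exact ⟨h1, Or.inl h2⟩
  · exact Or.inl hz

/-- Continuous open maps send the hull of an open set into the hull of the image. -/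
lemma image_hull_subset {d : ℕ}
    (f : EuclideanSpace ℝ (Fin d) → EuclideanSpace ℝ (Fin d))
    (hf_cont : Continuous f) (hf_open : IsOpenMap f)
    (U : Set (EuclideanSpace ℝ (Fin d))) (hU_open : IsOpen U) :
    f '' hull U ⊆ hull (f '' U) := by
  rintro _ ⟨x, hx | ⟨hx, hb⟩, rfl⟩
  · exact Or.inl ⟨x, hx, rfl⟩
  by_cases hfx : f x ∈ f '' U
  · exact Or.inl hfx
  refine Or.inr ⟨hfx, ?_⟩
  obtain ⟨N, hN, hxN, hNW, hop⟩ := exists_compact_nbhd U hU_open x hx hb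
  have hfN : IsCompact (f '' N) := hN.image hf_cont
  refine hfN.isBounded.subset ?_
  refine subset_of_clopen_piece isPreconnected_connectedComponentIn hfN.isClosed
    (hf_open _ hop) ?_ ⟨f x, mem_connectedComponentIn hfx, x, hxN, rfl⟩
  ext w
  constructor
  · rintro ⟨h1, u, h2 | h2, rfl⟩
    · exact ⟨h1, u, h2, rfl⟩
    · exact absurd ⟨u, h2, rfl⟩ (connectedComponentIn_subset _ _ h1)
  · rintro ⟨h1, u, h2, rfl⟩
    exact ⟨h1, u, Or.inl h2, rfl⟩

/-- Points in the closure of the hull lie in the hull or in the closure of the set. -/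
lemma closure_hull_subset {d : ℕ} (W : Set (EuclideanSpace ℝ (Fin d))) :
    closure (hull W) ⊆ hull W ∪ closure W := by
  intro y hy
  by_contra hnot
  simp only [mem_union, not_or] at hnot
  obtain ⟨hyV, hyW⟩ := hnot
  obtain ⟨r, hr, hball⟩ := Metric.isOpen_iff.mp isClosed_closure.isOpen_compl y hyW
  have hball' : Metric.ball y r ⊆ Wᶜ := fun z hz hzW => hball hz (subset_closure hzW)
  obtain ⟨z, hzV, hzr⟩ := Metric.mem_closure_iff.mp hy r hr
  have hz : z ∈ Metric.ball y r := by rwa [Metric.mem_ball, dist_comm]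
  have hyb : y ∈ Metric.ball y r := Metric.mem_ball_self hr
  rcases hzV with h | ⟨-, h⟩
  · exact hball' hz h
  · apply hyV
    refine Or.inr ⟨hball' hyb, ?_⟩
    have hmem : z ∈ connectedComponentIn Wᶜ y :=
      (convex_ball y r).isPreconnected.subset_connectedComponentIn hyb hball' hz
    rwa [connectedComponentIn_eq hmem]

theorem stmt_10 (d : ℕ) (hd : 2 ≤ d)
    (f : EuclideanSpace ℝ (Fin d) → EuclideanSpace ℝ (Fin d))
    (hf_cont : Continuous f) (hf_open : IsOpenMap f)
    (U : Set (EuclideanSpace ℝ (Fin d)))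
    (hU_open : IsOpen U) (hU_bdd : IsBounded U) :
    frontier (hull (f '' U)) ⊆ f '' frontier (hull U) := by
  intro y hy
  rw [(isOpen_hull _ (hf_open U hU_open)).frontier_eq] at hy
  obtain ⟨hycl, hyV⟩ := hy
  have hyW := (closure_hull_subset _ hycl).resolve_left hyV
  have hcl : IsClosed (f '' closure U) := (hU_bdd.isCompact_closure.image hf_cont).isClosed
  obtain ⟨x, hx, rfl⟩ := closure_minimal (image_mono subset_closure) hcl hyW
  refine ⟨x, ?_, rfl⟩
  rw [(isOpen_hull _ hU_open).frontier_eq]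
  exact ⟨closure_mono subset_union_left hx,
    fun hxH => hyV (image_hull_subset f hf_cont hf_open U hU_open ⟨x, hxH, rfl⟩)⟩
end

section
/- Let d ≥ 2 and let f : ℝ^d → ℝ^d be continuous, open and discrete. Let U ⊆ ℝ^d be a bounded normal domain of f, i.e. a bounded domain with f(∂U) = ∂f(U), and let E ⊆ f(U) be a continuum (a nonempty compact connected set). Then f maps every connected component of U ∩ f⁻¹(E) onto E. -/
open Set Bornology

theorem open_map_component_surj {X Y : Type*} [TopologicalSpace X] [CompactSpace X] [T2Space X]
    [TopologicalSpace Y] [T2Space Y] [ConnectedSpace Y] (g : X → Y) (hc : Continuous g)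
    (ho : IsOpenMap g) (x : X) (y : Y) : ∃ z ∈ connectedComponent x, g z = y := by
  have key : ∀ V : Set X, IsClopen V → x ∈ V → ∃ z ∈ V, g z = y := by
    intro V hV hx
    have h1 : IsClopen (g '' V) := ⟨hc.isClosedMap _ hV.1, ho _ hV.2⟩
    have h2 : g '' V = univ := h1.eq_univ ⟨g x, mem_image_of_mem g hx⟩
    have h3 : y ∈ g '' V := by rw [h2]; trivial
    exact h3
  have hne : (⋂ s : { s : Set X // IsClopen s ∧ x ∈ s }, (s.1 ∩ g ⁻¹' {y})).Nonempty := by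
    haveI : Nonempty { s : Set X // IsClopen s ∧ x ∈ s } := ⟨⟨univ, isClopen_univ, mem_univ x⟩⟩
    have hcl : ∀ s : { s : Set X // IsClopen s ∧ x ∈ s }, IsClosed (s.1 ∩ g ⁻¹' {y}) :=
      fun s => s.2.1.1.inter (isClosed_singleton.preimage hc)
    apply IsCompact.nonempty_iInter_of_directed_nonempty_isCompact_isClosed
    · intro s t
      refine ⟨⟨s.1 ∩ t.1, s.2.1.inter t.2.1, s.2.2, t.2.2⟩, ?_, ?_⟩
      · exact fun z hz => ⟨hz.1.1, hz.2⟩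
      · exact fun z hz => ⟨hz.1.2, hz.2⟩
    · intro s
      obtain ⟨z, hz, hzy⟩ := key s.1 s.2.1 s.2.2
      exact ⟨z, hz, hzy⟩
    · exact fun s => (hcl s).isCompact
    · exact hcl
  obtain ⟨z, hz⟩ := hne
  rw [mem_iInter] at hz
  refine ⟨z, ?_, (hz ⟨univ, isClopen_univ, mem_univ x⟩).2⟩
  rw [connectedComponent_eq_iInter_isClopen, mem_iInter]
  exact fun s => (hz s).1

theorem stmt_11 (d : ℕ) (hd : 2 ≤ d)
    (f : EuclideanSpace ℝ (Fin d) → EuclideanSpace ℝ (Fin d))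
    (hf_cont : Continuous f) (hf_open : IsOpenMap f)
    (hf_disc : ∀ y : EuclideanSpace ℝ (Fin d),
      DiscreteTopology ↥(f ⁻¹' {y}))
    (U : Set (EuclideanSpace ℝ (Fin d)))
    (hU_open : IsOpen U) (hU_conn : IsConnected U) (hU_bdd : IsBounded U)
    (hU_normal : f '' frontier U = frontier (f '' U))
    (E : Set (EuclideanSpace ℝ (Fin d)))
    (hE_sub : E ⊆ f '' U) (hE_comp : IsCompact E) (hE_conn : IsConnected E) :
    ∀ x ∈ U ∩ f ⁻¹' E, f '' connectedComponentIn (U ∩ f ⁻¹' E) x = E := by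
  intro x hx
  have hfU : IsOpen (f '' U) := hf_open _ hU_open
  have hK : U ∩ f ⁻¹' E = closure U ∩ f ⁻¹' E := by
    apply Subset.antisymm (inter_subset_inter_left _ subset_closure)
    rintro z ⟨hz, hzE⟩
    refine ⟨?_, hzE⟩
    by_contra hzU
    have h1 : z ∈ frontier U := by
      rw [hU_open.frontier_eq]
      exact ⟨hz, hzU⟩
    have h2 : f z ∈ frontier (f '' U) := hU_normal ▸ mem_image_of_mem f h1
    rw [hfU.frontier_eq] at h2
    exact h2.2 (hE_sub hzE)
  have hKc : IsCompact (U ∩ f ⁻¹' E) := by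
    rw [hK]
    exact hU_bdd.isCompact_closure.inter_right (hE_comp.isClosed.preimage hf_cont)
  haveI : CompactSpace ↥(U ∩ f ⁻¹' E) := isCompact_iff_compactSpace.1 hKc
  haveI : ConnectedSpace ↥E := isConnected_iff_connectedSpace.1 hE_conn
  let g : ↥(U ∩ f ⁻¹' E) → ↥E := fun z => ⟨f z.1, z.2.2⟩
  have hgc : Continuous g := (hf_cont.comp continuous_subtype_val).subtype_mk _
  have hgo : IsOpenMap g := by
    rintro _ ⟨O, hO, rfl⟩
    refine ⟨f '' (O ∩ U), hf_open _ (hO.inter hU_open), ?_⟩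
    ext y
    constructor
    · rintro ⟨z, ⟨hzO, hzU⟩, hzy⟩
      exact ⟨⟨z, hzU, by rw [mem_preimage, hzy]; exact y.2⟩, hzO, Subtype.ext hzy⟩
    · rintro ⟨z, hzO, rfl⟩
      exact ⟨z.1, ⟨hzO, z.2.1⟩, rfl⟩
  apply Subset.antisymm
  · rintro _ ⟨z, hz, rfl⟩
    exact (connectedComponentIn_subset _ _ hz).2
  · intro y hy
    obtain ⟨z, hz, hzy⟩ := open_map_component_surj g hgc hgo ⟨x, hx⟩ ⟨y, hy⟩
    rw [connectedComponentIn_eq_image hx]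
    exact ⟨z.1, ⟨z, hz, rfl⟩, congrArg Subtype.val hzy⟩
end
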